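/- Let q be the quadratic form in 9 variables q(B) = −b₁₁b₄₄ − b₂₂b₃₃ − 2b₁₂b₃₄ − 2b₁₃b₂₄ − 2b₁₄². Identify a tuple B = (b₁₁,b₁₂,b₁₃,b₁₄,b₂₂,b₂₄,b₃₃,b₃₄,b₄₄) with the symmetric 4×4 matrix having these entries and with (2,3)-entry equal to −b₁₄. Let A₀ be the 4×4 anti-diagonal matrix of 1's, and say an integer tuple B is ℚ-distinguished if f_B(x) = det(A₀x − B) has no repeated roots over ℂ and there exist linearly independent v, w ∈ ℚ⁴ with vᵀA₀v = vᵀBv = wᵀA₀w = vᵀA₀w = vᵀBw = 0. Fix a real δ with 0 < δ < 0.01 and positive constants c₁, c₂. Let ℬ be a box {|b_ij| ≤ X_ij} in ℝ⁹ where the nine positive reals X_ij satisfy c₁⁻¹X^{1−2δ} ≤ X_ij ≤ c₁X^{1+2δ}, X₁₄ = c₂X, and X₁₁X₄₄ = X₂₂X₃₃ = X₁₂X₃₄ = X₁₃X₂₄ = c₂²X². Let N_q^dist(ℬ) be the number of integer tuples B ∈ ℬ that are ℚ-distinguished and satisfy q(B) = 0. Then for every ε > 0 there is a constant C (depending on c₁,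 c₂, δ, ε) such that N_q^dist(ℬ) ≤ C·X^{209/30 + (137/45)δ + ε} for all X ≥ 1. -/

import Mathlib

open Matrix

/-- The 4×4 anti-diagonal matrix of 1's. -/
def A0 (R : Type*) [Zero R] [One R] : Matrix (Fin 4) (Fin 4) R :=
  !![0, 0, 0, 1; 0, 0, 1, 0; 0, 1, 0, 0; 1, 0, 0, 0]

/-- The quadratic form q(B) = -b₁₁b₄₄ - b₂₂b₃₃ - 2b₁₂b₃₄ - 2b₁₃b₂₄ - 2b₁₄², with
coordinates (b₁₁,b₁₂,b₁₃,b₁₄,b₂₂,b₂₄,b₃₃,b₃₄,b₄₄) indexed by Fin 9. -/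
def qformZ (b : Fin 9 → ℤ) : ℤ :=
  -(b 0 * b 8) - b 4 * b 6 - 2 * (b 1 * b 7) - 2 * (b 2 * b 5) - 2 * (b 3) ^ 2

/-- The symmetric 4×4 matrix over ℚ attached to a 9-tuple, with (2,3)-entry -b₁₄. -/
def matOf (b : Fin 9 → ℤ) : Matrix (Fin 4) (Fin 4) ℚ :=
  !![(b 0 : ℚ), b 1, b 2, b 3;
     (b 1 : ℚ), b 4, -(b 3 : ℚ), b 5;
     (b 2 : ℚ), -(b 3 : ℚ), b 6, b 7;
     (b 3 : ℚ), b 5, b 7, b 8]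

/-- A tuple is ℚ-distinguished if f_B = det(A₀x - B) has no repeated roots over ℂ and
there are linearly independent v, w ∈ ℚ⁴ with vᵀA₀v = vᵀBv = wᵀA₀w = vᵀA₀w = vᵀBw = 0. -/
def QDist (b : Fin 9 → ℤ) : Prop :=
  (∀ z : ℂ, ¬ ((Polynomial.X - Polynomial.C z) ^ 2 ∣
    (Matrix.det ((Polynomial.X : Polynomial ℚ) • ((A0 ℚ).map Polynomial.C) -
      (matOf b).map Polynomial.C)).map (algebraMap ℚ ℂ))) ∧
  ∃ v w : Fin 4 → ℚ, LinearIndependent ℚ ![v, w] ∧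
    v ⬝ᵥ (A0 ℚ).mulVec v = 0 ∧ v ⬝ᵥ (matOf b).mulVec v = 0 ∧
    w ⬝ᵥ (A0 ℚ).mulVec w = 0 ∧ v ⬝ᵥ (A0 ℚ).mulVec w = 0 ∧
    v ⬝ᵥ (matOf b).mulVec w = 0


structure Tup where
  (a x d c y e p z r m n : ℤ)

namespace Tup

def pr (t : Tup) : Fin 9 → ℤ := ![t.a, t.x, t.p, t.z, t.d, t.r, t.c, t.y, t.e]
def Q1 (t : Tup) : ℤ := t.m ^ 2 * t.a + 2 * t.m * t.n * t.x + t.n ^ 2 * t.d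
def Q2 (t : Tup) : ℤ := t.m ^ 2 * t.c - 2 * t.m * t.n * t.y + t.n ^ 2 * t.e
def Q12 (t : Tup) : ℤ := t.m ^ 2 * t.p - 2 * t.m * t.n * t.z - t.n ^ 2 * t.r

structure Good (T : ℕ) (t : Tup) : Prop where
  ha : |t.a| ≤ (T : ℤ) ^ 3
  hx : |t.x| ≤ (T : ℤ) ^ 3
  hd : |t.d| ≤ (T : ℤ) ^ 3
  hc : |t.c| ≤ (T : ℤ) ^ 3
  hy : |t.y| ≤ (T : ℤ) ^ 3
  he : |t.e| ≤ (T : ℤ) ^ 3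
  hp : |t.p| ≤ (T : ℤ) ^ 3
  hz : |t.z| ≤ (T : ℤ) ^ 3
  hr : |t.r| ≤ (T : ℤ) ^ 3
  hq : t.a * t.e + t.d * t.c + 2 * (t.x * t.y) + 2 * (t.p * t.r) + 2 * t.z ^ 2 = 0
  hg : t.Q12 ^ 2 = t.Q1 * t.Q2
  hcop : IsCoprime t.m t.n

end Tup

open Tup

/-- The 9-tuples underlying the extended tuples with property `P` number at most `k`. -/
def Cn (P : Tup → Prop) (k : ℕ) : Prop :=
  ∃ F : Finset (Fin 9 → ℤ), F.card ≤ k ∧ ∀ t, P t → t.pr ∈ F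

theorem Cn.mono {P Q : Tup → Prop} {k l : ℕ} (h : Cn P k) (hQ : ∀ t, Q t → P t) (hk : k ≤ l) :
    Cn Q l := by
  obtain ⟨F, hF, h⟩ := h
  exact ⟨F, hF.trans hk, fun t ht => h t (hQ t ht)⟩

theorem Cn.or {P Q : Tup → Prop} {k l : ℕ} (h : Cn P k) (h' : Cn Q l) :
    Cn (fun t => P t ∨ Q t) (k + l) := by
  classical
  obtain ⟨F, hF, h⟩ := h
  obtain ⟨G, hG, h'⟩ := h'
  refine ⟨F ∪ G, (Finset.card_union_le _ _).trans (by omega), ?_⟩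
  rintro t (ht | ht)
  · exact Finset.mem_union_left _ (h t ht)
  · exact Finset.mem_union_right _ (h' t ht)

theorem Cn.base {P : Tup → Prop} {k : ℕ} (h : ∀ t, P t → Cn P k) : Cn P k := by
  by_cases hP : ∃ t, P t
  · obtain ⟨t, ht⟩ := hP
    exact h t ht
  · push Not at hP
    exact ⟨∅, by simp, fun t ht => absurd ht (hP t)⟩

theorem Cn.single {P : Tup → Prop} (h : ∀ t s, P t → P s → t.pr = s.pr) : Cn P 1 := by
  apply Cn.base
  intro t ht
  exact ⟨{t.pr}, by simp, fun s hs => by simp [h s t hs ht]⟩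

theorem Cn.step {P : Tup → Prop} {K k : ℕ} (f : Tup → ℤ) (V : Finset ℤ) (hV : V.card ≤ K)
    (h : ∀ t, P t → f t ∈ V) (hf : ∀ v, Cn (fun t => P t ∧ f t = v) k) : Cn P (K * k) := by
  classical
  choose F hF hF' using hf
  refine ⟨V.biUnion F, ?_, ?_⟩
  · calc (V.biUnion F).card ≤ V.card * k := Finset.card_biUnion_le_card_mul _ _ _ (fun v _ => hF v)
      _ ≤ K * k := Nat.mul_le_mul_right _ hV
  · intro t ht
    exact Finset.mem_biUnion.2 ⟨f t, h t ht, hF' _ t ⟨ht, rfl⟩⟩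

theorem Cn.box {P : Tup → Prop} {k B : ℕ} (hB : 1 ≤ B) (f : Tup → ℤ)
    (h : ∀ t, P t → |f t| ≤ (B : ℤ)) (hf : ∀ v, Cn (fun t => P t ∧ f t = v) k) :
    Cn P (3 * B * k) := by
  refine Cn.step f (Finset.Icc (-(B : ℤ)) B) ?_ ?_ hf
  · simp only [Int.card_Icc]; omega
  · intro t ht
    have := abs_le.1 (h t ht)
    exact Finset.mem_Icc.2 this

theorem Cn.near {P : Tup → Prop} {k B : ℕ} (hB : 1 ≤ B) (f : Tup → ℤ) (m : ℤ)
    (h : ∀ t s, P t → P s → ∃ j, f t - f s = m * j ∧ |j| ≤ (B : ℤ))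
    (hf : ∀ v, Cn (fun t => P t ∧ f t = v) k) :
    Cn P (3 * B * k) := by
  classical
  apply Cn.base
  intro s hs
  refine Cn.step f ((Finset.Icc (-(B : ℤ)) B).image (fun j => f s + m * j)) ?_ ?_ hf
  · refine Finset.card_image_le.trans ?_
    simp only [Int.card_Icc]; omega
  · intro t ht
    obtain ⟨j, hj, hj'⟩ := h t s ht hs
    exact Finset.mem_image.2 ⟨j, Finset.mem_Icc.2 (abs_le.1 hj'), by linarith⟩

theorem Cn.quad {P : Tup → Prop} {k : ℕ} (f : Tup → ℤ) (A B C : ℤ) (hA : ∀ t, P t → A ≠ 0)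
    (h : ∀ t, P t → A * f t ^ 2 + B * f t + C = 0)
    (hf : ∀ v, Cn (fun t => P t ∧ f t = v) k) :
    Cn P (2 * k) := by
  classical
  apply Cn.base
  intro s hs
  have hA := hA s hs
  refine Cn.step f ({f s, -B / A - f s} : Finset ℤ) Finset.card_le_two ?_ hf
  intro t ht
  simp only [Finset.mem_insert, Finset.mem_singleton]
  by_cases he : f t = f s
  · exact Or.inl he
  · right
    have h1 : A * (f t + f s) + B = 0 := by
      have : (f t - f s) * (A * (f t + f s) + B) = 0 := by linear_combination h t ht - h s hs
      exact (mul_eq_zero.1 this).resolve_left (sub_ne_zero.2 he)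
    have : -B / A = f t + f s := by
      rw [show -B = A * (f t + f s) by linarith]
      exact Int.mul_ediv_cancel_left _ hA
    rw [this]; ring

def DivB (T D : ℕ) : Prop := ∀ w : ℤ, w ≠ 0 → |w| ≤ 256 * (T : ℤ) ^ 30 →
  ∃ V : Finset ℤ, V.card ≤ D ∧ ∀ d, d ∣ w → d ∈ V

theorem Cn.dvd {P : Tup → Prop} {k T D : ℕ} (HD : DivB T D) (f : Tup → ℤ) (w : ℤ)
    (h : ∀ t, P t → f t ∣ w) (h0 : ∀ t, P t → w ≠ 0) (hw : ∀ t, P t → |w| ≤ 256 * (T : ℤ) ^ 30)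
    (hf : ∀ v, Cn (fun t => P t ∧ f t = v) k) :
    Cn P (D * k) := by
  apply Cn.base
  intro s hs
  obtain ⟨V, hV, hV'⟩ := HD w (h0 s hs) (hw s hs)
  exact Cn.step f V hV (fun t ht => hV' _ (h t ht)) hf

theorem Cn.symm {P : Tup → Prop} {k : ℕ} (σ : Tup → Tup) (τ : (Fin 9 → ℤ) → (Fin 9 → ℤ))
    (hτ : ∀ t, τ (σ t).pr = t.pr) {Q : Tup → Prop} (h : Cn Q k) (hPQ : ∀ t, P t → Q (σ t)) :
    Cn P k := by
  classical
  obtain ⟨F, hF, h⟩ := h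
  refine ⟨F.image τ, Finset.card_image_le.trans hF, fun t ht => ?_⟩
  exact Finset.mem_image.2 ⟨_, h _ (hPQ t ht), hτ t⟩

def s1 (t : Tup) : Tup := ⟨t.c, -t.y, t.e, t.a, -t.x, t.d, t.p, t.z, t.r, t.m, t.n⟩
def s2 (t : Tup) : Tup := ⟨t.d, t.x, t.a, t.e, t.y, t.c, -t.r, t.z, -t.p, t.n, t.m⟩

-- pr order: a x p z d r c y e
theorem Cn.s1 {P Q : Tup → Prop} {k : ℕ} (h : Cn Q k) (hPQ : ∀ t, P t → Q (s1 t)) : Cn P k := by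
  refine Cn.symm _root_.s1 (fun v => ![v 6, -v 7, v 2, v 3, v 8, v 5, v 0, -v 1, v 4]) ?_ h hPQ
  intro t
  simp [pr, _root_.s1]

theorem Cn.s2 {P Q : Tup → Prop} {k : ℕ} (h : Cn Q k) (hPQ : ∀ t, P t → Q (s2 t)) : Cn P k := by
  refine Cn.symm _root_.s2 (fun v => ![v 4, v 1, -v 5, v 3, v 0, -v 2, v 8, v 7, v 6]) ?_ h hPQ
  intro t
  simp [pr, _root_.s2]

theorem Tup.Good.s1 {T : ℕ} {t : Tup} (h : Good T t) : Good T (s1 t) where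
  ha := h.hc
  hx := by simpa [_root_.s1] using h.hy
  hd := h.he
  hc := h.ha
  hy := by simpa [_root_.s1] using h.hx
  he := h.hd
  hp := h.hp
  hz := h.hz
  hr := h.hr
  hq := by have := h.hq; simp only [_root_.s1]; linear_combination this
  hg := by have := h.hg; simp only [_root_.s1, Q1, Q2, Q12] at *; linear_combination this
  hcop := h.hcop

theorem Tup.Good.s2 {T : ℕ} {t : Tup} (h : Good T t) : Good T (s2 t) where
  ha := h.hd
  hx := h.hx
  hd := h.ha
  hc := h.he
  hy := h.hy
  he := h.hc
  hp := by simpa [_root_.s2] using h.hr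
  hz := h.hz
  hr := by simpa [_root_.s2] using h.hp
  hq := by have := h.hq; simp only [_root_.s2]; linear_combination this
  hg := by have := h.hg; simp only [_root_.s2, Q1, Q2, Q12] at *; linear_combination this
  hcop := h.hcop.symm

theorem pr_eq {t s : Tup} (ha : t.a = s.a) (hx : t.x = s.x) (hd : t.d = s.d) (hc : t.c = s.c)
    (hy : t.y = s.y) (he : t.e = s.e) (hp : t.p = s.p) (hz : t.z = s.z) (hr : t.r = s.r) :
    t.pr = s.pr := by
  simp [pr, ha, hx, hd, hc, hy, he, hp, hz, hr]

theorem abs_mul_le {a b A B : ℤ} (ha : |a| ≤ A) (hb : |b| ≤ B) : |a * b| ≤ A * B := by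
  rw [abs_mul]
  exact mul_le_mul ha hb (abs_nonneg _) ((abs_nonneg _).trans ha)

theorem abs_add_le' {a b A B : ℤ} (ha : |a| ≤ A) (hb : |b| ≤ B) : |a + b| ≤ A + B :=
  (abs_add_le _ _).trans (add_le_add ha hb)

theorem abs_sub_le' {a b A B : ℤ} (ha : |a| ≤ A) (hb : |b| ≤ B) : |a - b| ≤ A + B :=
  (abs_sub _ _).trans (add_le_add ha hb)

theorem pow_le_T30 {T : ℕ} (hT : 1 ≤ T) {j : ℕ} (hj : j ≤ 30) (c : ℤ) (hc0 : 0 ≤ c) (hc : c ≤ 256) :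
    c * (T : ℤ) ^ j ≤ 256 * (T : ℤ) ^ 30 := by
  have h1 : (1 : ℤ) ≤ T := by exact_mod_cast hT
  have := pow_le_pow_right₀ h1 hj
  have h0 : (0 : ℤ) ≤ (T : ℤ) ^ 30 := by positivity
  have : c * (T : ℤ) ^ j ≤ c * (T : ℤ) ^ 30 := mul_le_mul_of_nonneg_left this hc0
  exact this.trans (mul_le_mul_of_nonneg_right hc h0)

open Tup

theorem six {T D : ℕ} (hT : 1 ≤ T) (HD : DivB T D) (a0 d0 c0 e0 p0 r0 : ℤ) :
    Cn (fun t => Good T t ∧ t.a = a0 ∧ t.d = d0 ∧ t.c = c0 ∧ t.e = e0 ∧ t.p = p0 ∧ t.r = r0)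
      (3 * T ^ 3 * (D * 1) + (3 * T ^ 3 * (2 * 1) + 3 * T ^ 3 * (2 * 1))) := by
  have hT3 : 1 ≤ T ^ 3 := Nat.one_le_pow _ _ hT
  have A : Cn (fun t => (Good T t ∧ t.a = a0 ∧ t.d = d0 ∧ t.c = c0 ∧ t.e = e0 ∧ t.p = p0 ∧ t.r = r0)
      ∧ t.x * t.y ≠ 0) (3 * T ^ 3 * (D * 1)) := by
    refine Cn.box hT3 (fun t => t.z) (fun t ht => by exact_mod_cast ht.1.1.hz) fun z0 => ?_
    have key : ∀ t, ((Good T t ∧ t.a = a0 ∧ t.d = d0 ∧ t.c = c0 ∧ t.e = e0 ∧ t.p = p0 ∧ t.r = r0)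
      ∧ t.x * t.y ≠ 0) ∧ t.z = z0 →
        -(a0 * e0 + d0 * c0 + 2 * (p0 * r0) + 2 * z0 ^ 2) = 2 * (t.x * t.y) := by
      rintro t ⟨⟨⟨h, rfl, rfl, rfl, rfl, rfl, rfl⟩, h0⟩, rfl⟩
      linear_combination -h.hq
    refine Cn.dvd HD (fun t => t.x) (-(a0 * e0 + d0 * c0 + 2 * (p0 * r0) + 2 * z0 ^ 2)) ?_ ?_ ?_ ?_
    · intro t ht
      rw [key t ht]
      exact ⟨2 * t.y, by ring⟩
    · intro t ht
      rw [key t ht]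
      exact mul_ne_zero two_ne_zero ht.1.2
    · intro t ht
      rw [key t ht]
      have := abs_mul_le (abs_mul_le (le_refl |(2 : ℤ)|) ht.1.1.1.hx) ht.1.1.1.hy
      rw [← mul_assoc]
      refine this.trans ?_
      have := pow_le_T30 hT (j := 6) (by norm_num) 2 (by norm_num) (by norm_num)
      rw [abs_two]
      linarith
    · intro x0
      apply Cn.single
      rintro t s ⟨ht, htx⟩ ⟨hs, hsx⟩
      have h1 := key t ht
      have h2 := key s hs
      obtain ⟨⟨⟨h, ha, hd, hc, he, hp, hr⟩, h0⟩, hz⟩ := ht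
      obtain ⟨⟨⟨h', ha', hd', hc', he', hp', hr'⟩, h0'⟩, hz'⟩ := hs
      have hx : t.x = s.x := by simp_all
      refine pr_eq (by simp_all) hx (by simp_all) (by simp_all) ?_ (by simp_all) (by simp_all)
        (by simp_all) (by simp_all)
      have hx0 : s.x ≠ 0 := left_ne_zero_of_mul h0'
      apply mul_left_cancel₀ hx0
      rw [hx] at h1
      linarith
  have B : Cn (fun t => (Good T t ∧ t.a = a0 ∧ t.d = d0 ∧ t.c = c0 ∧ t.e = e0 ∧ t.p = p0 ∧ t.r = r0)
      ∧ t.x = 0) (3 * T ^ 3 * (2 * 1)) := by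
    refine Cn.box hT3 (fun t => t.y) (fun t ht => by exact_mod_cast ht.1.1.hy) fun z0 => ?_
    refine Cn.quad (fun t => t.z) 2 0 (a0 * e0 + d0 * c0 + 2 * (p0 * r0)) (fun _ _ => by norm_num) ?_ ?_
    · rintro t ⟨⟨⟨h, rfl, rfl, rfl, rfl, rfl, rfl⟩, h0⟩, rfl⟩
      have := h.hq
      rw [h0] at this
      linear_combination this
    · intro v
      apply Cn.single
      rintro t s ⟨⟨⟨⟨h, ha, hd, hc, he, hp, hr⟩, h0⟩, hy⟩, hz⟩ ⟨⟨⟨⟨h', ha', hd', hc', he', hp', hr'⟩, h0'⟩, hy'⟩, hz'⟩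
      apply pr_eq <;> simp_all
  have C : Cn (fun t => (Good T t ∧ t.a = a0 ∧ t.d = d0 ∧ t.c = c0 ∧ t.e = e0 ∧ t.p = p0 ∧ t.r = r0)
      ∧ t.y = 0) (3 * T ^ 3 * (2 * 1)) := by
    refine Cn.box hT3 (fun t => t.x) (fun t ht => by exact_mod_cast ht.1.1.hx) fun z0 => ?_
    refine Cn.quad (fun t => t.z) 2 0 (a0 * e0 + d0 * c0 + 2 * (p0 * r0)) (fun _ _ => by norm_num) ?_ ?_
    · rintro t ⟨⟨⟨h, rfl, rfl, rfl, rfl, rfl, rfl⟩, h0⟩, rfl⟩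
      have := h.hq
      rw [h0] at this
      linear_combination this
    · intro v
      apply Cn.single
      rintro t s ⟨⟨⟨⟨h, ha, hd, hc, he, hp, hr⟩, h0⟩, hy⟩, hz⟩ ⟨⟨⟨⟨h', ha', hd', hc', he', hp', hr'⟩, h0'⟩, hy'⟩, hz'⟩
      apply pr_eq <;> simp_all
  refine (A.or (B.or C)).mono ?_ le_rfl
  intro t ht
  by_cases hx : t.x = 0
  · exact Or.inr (Or.inl ⟨ht, hx⟩)
  by_cases hy : t.y = 0
  · exact Or.inr (Or.inr ⟨ht, hy⟩)
  · exact Or.inl ⟨ht, mul_ne_zero hx hy⟩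

theorem six' {T D : ℕ} (hT : 1 ≤ T) (hD : 1 ≤ D) (HD : DivB T D) (a0 d0 c0 e0 p0 r0 : ℤ) :
    Cn (fun t => Good T t ∧ t.a = a0 ∧ t.d = d0 ∧ t.c = c0 ∧ t.e = e0 ∧ t.p = p0 ∧ t.r = r0)
      (15 * T ^ 3 * D) := by
  refine (six hT HD a0 d0 c0 e0 p0 r0).mono (fun t h => h) ?_
  have : T ^ 3 * 1 ≤ T ^ 3 * D := Nat.mul_le_mul_left _ hD
  nlinarith

theorem bad_a {T D : ℕ} (hT : 1 ≤ T) (hD : 1 ≤ D) (HD : DivB T D) :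
    Cn (fun t => Good T t ∧ t.a = 0) (10000 * T ^ 18 * D) := by
  have hT3 : 1 ≤ T ^ 3 := Nat.one_le_pow _ _ hT
  have : Cn (fun t => Good T t ∧ t.a = 0)
      (3 * T ^ 3 * (3 * T ^ 3 * (3 * T ^ 3 * (3 * T ^ 3 * (3 * T ^ 3 * (15 * T ^ 3 * D)))))) := by
    refine Cn.box hT3 (fun t => t.d) (fun t ht => by exact_mod_cast ht.1.hd) fun d0 => ?_
    refine Cn.box hT3 (fun t => t.c) (fun t ht => by exact_mod_cast ht.1.1.hc) fun c0 => ?_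
    refine Cn.box hT3 (fun t => t.e) (fun t ht => by exact_mod_cast ht.1.1.1.he) fun e0 => ?_
    refine Cn.box hT3 (fun t => t.p) (fun t ht => by exact_mod_cast ht.1.1.1.1.hp) fun p0 => ?_
    refine Cn.box hT3 (fun t => t.r) (fun t ht => by exact_mod_cast ht.1.1.1.1.1.hr) fun r0 => ?_
    refine (six' hT hD HD 0 d0 c0 e0 p0 r0).mono ?_ le_rfl
    rintro t ⟨⟨⟨⟨⟨⟨h, ha⟩, hd⟩, hc⟩, he⟩, hp⟩, hr⟩
    exact ⟨h, ha, hd, hc, he, hp, hr⟩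
  refine this.mono (fun t h => h) ?_
  have : 0 ≤ T ^ 18 * D := Nat.zero_le _
  ring_nf
  nlinarith

theorem bad_g {T D : ℕ} (hT : 1 ≤ T) (hD : 1 ≤ D) (HD : DivB T D) :
    Cn (fun t => Good T t ∧ t.a ≠ 0 ∧ t.p ^ 2 = t.a * t.c) (10000 * T ^ 18 * D) := by
  have hT3 : 1 ≤ T ^ 3 := Nat.one_le_pow _ _ hT
  have : Cn (fun t => Good T t ∧ t.a ≠ 0 ∧ t.p ^ 2 = t.a * t.c)
      (3 * T ^ 3 * (3 * T ^ 3 * (3 * T ^ 3 * (3 * T ^ 3 * (3 * T ^ 3 * (15 * T ^ 3 * D)))))) := by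
    refine Cn.box hT3 (fun t => t.d) (fun t ht => by exact_mod_cast ht.1.hd) fun d0 => ?_
    refine Cn.box hT3 (fun t => t.a) (fun t ht => by exact_mod_cast ht.1.1.ha) fun a0 => ?_
    refine Cn.box hT3 (fun t => t.e) (fun t ht => by exact_mod_cast ht.1.1.1.he) fun e0 => ?_
    refine Cn.box hT3 (fun t => t.p) (fun t ht => by exact_mod_cast ht.1.1.1.1.hp) fun p0 => ?_
    refine Cn.box hT3 (fun t => t.r) (fun t ht => by exact_mod_cast ht.1.1.1.1.1.hr) fun r0 => ?_
    refine (six' hT hD HD a0 d0 (p0 ^ 2 / a0) e0 p0 r0).mono ?_ le_rfl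
    rintro t ⟨⟨⟨⟨⟨⟨h, ha0, hc⟩, rfl⟩, rfl⟩, rfl⟩, rfl⟩, rfl⟩
    refine ⟨h, rfl, rfl, ?_, rfl, rfl, rfl⟩
    rw [hc, Int.mul_ediv_cancel_left _ ha0]
  refine this.mono (fun t h => h) ?_
  have : 0 ≤ T ^ 18 * D := Nat.zero_le _
  ring_nf
  nlinarith

def Tup.R (t : Tup) : ℤ :=
  4 * (t.d * t.p + t.r * t.a) * (t.r * t.c + t.e * t.p) + (t.d * t.c - t.e * t.a) ^ 2

theorem bad_R {T D : ℕ} (hT : 1 ≤ T) (hD : 1 ≤ D) (HD : DivB T D) :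
    Cn (fun t => Good T t ∧ t.a ≠ 0 ∧ t.R = 0) (10000 * T ^ 18 * D) := by
  have hT3 : 1 ≤ T ^ 3 := Nat.one_le_pow _ _ hT
  have : Cn (fun t => Good T t ∧ t.a ≠ 0 ∧ t.R = 0)
      (3 * T ^ 3 * (3 * T ^ 3 * (3 * T ^ 3 * (3 * T ^ 3 * (3 * T ^ 3 * (2 * (15 * T ^ 3 * D))))))) := by
    refine Cn.box hT3 (fun t => t.d) (fun t ht => by exact_mod_cast ht.1.hd) fun d0 => ?_
    refine Cn.box hT3 (fun t => t.a) (fun t ht => by exact_mod_cast ht.1.1.ha) fun a0 => ?_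
    refine Cn.box hT3 (fun t => t.c) (fun t ht => by exact_mod_cast ht.1.1.1.hc) fun c0 => ?_
    refine Cn.box hT3 (fun t => t.p) (fun t ht => by exact_mod_cast ht.1.1.1.1.hp) fun p0 => ?_
    refine Cn.box hT3 (fun t => t.r) (fun t ht => by exact_mod_cast ht.1.1.1.1.1.hr) fun r0 => ?_
    refine Cn.quad (fun t => t.e) (a0 ^ 2) (4 * (d0 * p0 + r0 * a0) * p0 - 2 * d0 * c0 * a0)
      (4 * (d0 * p0 + r0 * a0) * r0 * c0 + d0 ^ 2 * c0 ^ 2) ?_ ?_ ?_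
    · rintro t ⟨⟨⟨⟨⟨⟨h, ha0, hR⟩, rfl⟩, rfl⟩, rfl⟩, rfl⟩, rfl⟩
      exact pow_ne_zero _ ha0
    · rintro t ⟨⟨⟨⟨⟨⟨h, ha0, hR⟩, rfl⟩, rfl⟩, rfl⟩, rfl⟩, rfl⟩
      unfold Tup.R at hR
      linear_combination hR
    intro e0
    refine (six' hT hD HD a0 d0 c0 e0 p0 r0).mono ?_ le_rfl
    rintro t ⟨⟨⟨⟨⟨⟨⟨h, ha0, hR⟩, rfl⟩, rfl⟩, rfl⟩, rfl⟩, rfl⟩, rfl⟩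
    exact ⟨h, rfl, rfl, rfl, rfl, rfl, rfl⟩
  refine this.mono (fun t h => h) ?_
  have : 0 ≤ T ^ 18 * D := Nat.zero_le _
  ring_nf
  nlinarith

/-- The generic tuples. -/
structure Tup.Gen (T : ℕ) (t : Tup) : Prop extends Good T t where
  a0 : t.a ≠ 0
  c0 : t.c ≠ 0
  d0 : t.d ≠ 0
  e0 : t.e ≠ 0
  g0 : t.p ^ 2 - t.a * t.c ≠ 0
  g4 : t.r ^ 2 - t.d * t.e ≠ 0
  R0 : t.R ≠ 0

theorem Tup.Gen.s1 {T : ℕ} {t : Tup} (h : Gen T t) : Gen T (s1 t) where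
  toGood := h.toGood.s1
  a0 := h.c0
  c0 := h.a0
  d0 := h.e0
  e0 := h.d0
  g0 := by have := h.g0; simp only [_root_.s1]; rwa [mul_comm]
  g4 := by have := h.g4; simp only [_root_.s1]; rwa [mul_comm]
  R0 := by
    have := h.R0; unfold Tup.R at *; simp only [_root_.s1]
    convert this using 1; ring

theorem Tup.Gen.s2 {T : ℕ} {t : Tup} (h : Gen T t) : Gen T (s2 t) where
  toGood := h.toGood.s2
  a0 := h.d0
  c0 := h.e0
  d0 := h.a0
  e0 := h.c0
  g0 := by have := h.g4; simp only [_root_.s2]; rwa [neg_sq]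
  g4 := by have := h.g0; simp only [_root_.s2]; rwa [neg_sq]
  R0 := by
    have := h.R0; unfold Tup.R at *; simp only [_root_.s2]
    convert this using 1; ring

theorem Tup.Good.quartic {T : ℕ} {t : Tup} (h : Good T t) :
    (t.p ^ 2 - t.a * t.c) * t.m ^ 4 + 2 * (-2 * t.p * t.z + t.a * t.y - t.x * t.c) * t.m ^ 3 * t.n
      + 6 * (t.x * t.y + t.z ^ 2) * t.m ^ 2 * t.n ^ 2
      + 2 * (2 * t.z * t.r + t.d * t.y - t.x * t.e) * t.m * t.n ^ 3
      + (t.r ^ 2 - t.d * t.e) * t.n ^ 4 = 0 := by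
  have h1 := h.hg
  have h2 := h.hq
  unfold Q1 Q2 Q12 at h1
  linear_combination h1 + t.m ^ 2 * t.n ^ 2 * h2

theorem Tup.Gen.n_dvd {T : ℕ} {t : Tup} (h : Gen T t) : t.n ∣ t.p ^ 2 - t.a * t.c := by
  have h1 := h.quartic
  have : t.n ∣ (t.p ^ 2 - t.a * t.c) * t.m ^ 4 :=
    ⟨-(2 * (-2 * t.p * t.z + t.a * t.y - t.x * t.c) * t.m ^ 3
      + 6 * (t.x * t.y + t.z ^ 2) * t.m ^ 2 * t.n
      + 2 * (2 * t.z * t.r + t.d * t.y - t.x * t.e) * t.m * t.n ^ 2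
      + (t.r ^ 2 - t.d * t.e) * t.n ^ 3), by linear_combination h1⟩
  exact (h.hcop.symm.pow_right (n := 4)).dvd_of_dvd_mul_right this

theorem Tup.Gen.m_dvd {T : ℕ} {t : Tup} (h : Gen T t) : t.m ∣ t.r ^ 2 - t.d * t.e := by
  have := h.s2.n_dvd
  simpa [_root_.s2] using this

theorem Tup.Gen.n0 {T : ℕ} {t : Tup} (h : Gen T t) : t.n ≠ 0 := by
  intro h0
  have := h.n_dvd
  rw [h0, zero_dvd_iff] at this
  exact h.g0 this

theorem Tup.Gen.m0 {T : ℕ} {t : Tup} (h : Gen T t) : t.m ≠ 0 := by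
  intro h0
  have := h.m_dvd
  rw [h0, zero_dvd_iff] at this
  exact h.g4 this

theorem Tup.Good.g0_le {T : ℕ} {t : Tup} (h : Good T t) :
    |t.p ^ 2 - t.a * t.c| ≤ 2 * (T : ℤ) ^ 6 := by
  rw [sq]
  refine (abs_sub_le' (abs_mul_le h.hp h.hp) (abs_mul_le h.ha h.hc)).trans (le_of_eq ?_)
  ring

theorem Tup.Good.g4_le {T : ℕ} {t : Tup} (h : Good T t) :
    |t.r ^ 2 - t.d * t.e| ≤ 2 * (T : ℤ) ^ 6 := by
  rw [sq]
  refine (abs_sub_le' (abs_mul_le h.hr h.hr) (abs_mul_le h.hd h.he)).trans (le_of_eq ?_)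
  ring

theorem abs_le_of_dvd' {a b : ℤ} (h : a ∣ b) (hb : b ≠ 0) : |a| ≤ |b| := by
  have := Int.le_of_dvd (abs_pos.2 hb) ((abs_dvd_abs a b).2 h)
  exact this

theorem Tup.Gen.n_le {T : ℕ} {t : Tup} (h : Gen T t) : |t.n| ≤ 2 * (T : ℤ) ^ 6 :=
  (abs_le_of_dvd' h.n_dvd h.g0).trans h.g0_le

theorem Tup.Gen.m_le {T : ℕ} {t : Tup} (h : Gen T t) : |t.m| ≤ 2 * (T : ℤ) ^ 6 :=
  (abs_le_of_dvd' h.m_dvd h.g4).trans h.g4_le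

theorem Tup.Gen.Q12_le {T : ℕ} {t : Tup} (h : Gen T t) : |t.Q12| ≤ 16 * (T : ℤ) ^ 15 := by
  have h1 := abs_mul_le (abs_mul_le h.m_le h.m_le) h.hp
  have h2 := abs_mul_le (abs_mul_le (abs_mul_le (le_refl |(2 : ℤ)|) h.m_le) h.n_le) h.hz
  have h3 := abs_mul_le (abs_mul_le h.n_le h.n_le) h.hr
  have := abs_sub_le' (abs_sub_le' h1 h2) h3
  unfold Q12
  rw [sq, sq]
  refine this.trans (le_of_eq ?_)
  rw [abs_two]; ring

theorem Tup.Gen.Q12sq_le {T : ℕ} {t : Tup} (h : Gen T t) : |t.Q12 ^ 2| ≤ 256 * (T : ℤ) ^ 30 := by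
  rw [sq]
  refine (abs_mul_le h.Q12_le h.Q12_le).trans (le_of_eq ?_)
  ring

open Tup

theorem T6_le {T : ℕ} (hT : 1 ≤ T) : 2 * (T : ℤ) ^ 6 ≤ 256 * (T : ℤ) ^ 30 :=
  pow_le_T30 hT (j := 6) (by norm_num) 2 (by norm_num) (by norm_num)

theorem T3_le {T : ℕ} (hT : 1 ≤ T) : (T : ℤ) ^ 3 ≤ 256 * (T : ℤ) ^ 30 := by
  have := pow_le_T30 hT (j := 3) (by norm_num) 1 (by norm_num) (by norm_num)
  linarith

theorem identW (t : Tup) :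
    t.n ^ 2 * (t.a * t.e + t.d * t.c + 2 * (t.x * t.y) + 2 * (t.p * t.r) + 2 * t.z ^ 2) =
    t.a * t.Q2 + t.c * t.Q1 + 2 * ((t.n * t.x + t.m * t.a) * (t.n * t.y - t.m * t.c)) +
      2 * t.n ^ 2 * (t.p * t.r + t.z ^ 2) := by
  unfold Q1 Q2; ring

theorem pieceZ {T D : ℕ} (hT : 1 ≤ T) (HD : DivB T D) :
    Cn (fun t => Gen T t ∧ t.Q12 = 0 ∧ t.Q1 = 0) (10000 * T ^ 18 * D ^ 2) := by
  have hT3 : 1 ≤ T ^ 3 := Nat.one_le_pow _ _ hT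
  have : Cn (fun t => Gen T t ∧ t.Q12 = 0 ∧ t.Q1 = 0)
      (3 * T ^ 3 * (3 * T ^ 3 * (3 * T ^ 3 * (3 * T ^ 3 * (3 * T ^ 3 * (3 * T ^ 3 * (D * (D * 1)))))))) := by
    refine Cn.box hT3 (fun t => t.a) (fun t ht => by exact_mod_cast ht.1.ha) fun a0 => ?_
    refine Cn.box hT3 (fun t => t.d) (fun t ht => by exact_mod_cast ht.1.1.hd) fun d0 => ?_
    refine Cn.box hT3 (fun t => t.p) (fun t ht => by exact_mod_cast ht.1.1.1.hp) fun p0 => ?_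
    refine Cn.box hT3 (fun t => t.r) (fun t ht => by exact_mod_cast ht.1.1.1.1.hr) fun r0 => ?_
    refine Cn.box hT3 (fun t => t.c) (fun t ht => by exact_mod_cast ht.1.1.1.1.1.hc) fun c0 => ?_
    refine Cn.box hT3 (fun t => t.y) (fun t ht => by exact_mod_cast ht.1.1.1.1.1.1.hy) fun y0 => ?_
    refine Cn.dvd HD (fun t => t.n) a0 ?_ ?_ ?_ fun n0 => ?_
    · rintro t ⟨⟨⟨⟨⟨⟨⟨h, h12, h1⟩, rfl⟩, rfl⟩, rfl⟩, rfl⟩, rfl⟩, rfl⟩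
      unfold Q1 at h1
      have : t.n ∣ t.a * t.m ^ 2 := ⟨-(2 * t.m * t.x + t.n * t.d), by linear_combination h1⟩
      exact (h.hcop.symm.pow_right (n := 2)).dvd_of_dvd_mul_right this
    · rintro t ⟨⟨⟨⟨⟨⟨⟨h, h12, h1⟩, rfl⟩, rfl⟩, rfl⟩, rfl⟩, rfl⟩, rfl⟩
      exact h.a0
    · rintro t ⟨⟨⟨⟨⟨⟨⟨h, h12, h1⟩, rfl⟩, rfl⟩, rfl⟩, rfl⟩, rfl⟩, rfl⟩
      exact h.ha.trans (T3_le hT)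
    refine Cn.dvd HD (fun t => t.m) d0 ?_ ?_ ?_ fun m0 => ?_
    · rintro t ⟨⟨⟨⟨⟨⟨⟨⟨h, h12, h1⟩, rfl⟩, rfl⟩, rfl⟩, rfl⟩, rfl⟩, rfl⟩, rfl⟩
      unfold Q1 at h1
      have : t.m ∣ t.d * t.n ^ 2 := ⟨-(2 * t.n * t.x + t.m * t.a), by linear_combination h1⟩
      exact (h.hcop.pow_right (n := 2)).dvd_of_dvd_mul_right this
    · rintro t ⟨⟨⟨⟨⟨⟨⟨⟨h, h12, h1⟩, rfl⟩, rfl⟩, rfl⟩, rfl⟩, rfl⟩, rfl⟩, rfl⟩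
      exact h.d0
    · rintro t ⟨⟨⟨⟨⟨⟨⟨⟨h, h12, h1⟩, rfl⟩, rfl⟩, rfl⟩, rfl⟩, rfl⟩, rfl⟩, rfl⟩
      exact h.hd.trans (T3_le hT)
    apply Cn.single
    rintro t s ⟨⟨⟨⟨⟨⟨⟨⟨⟨h, h12, h1⟩, ha⟩, hd⟩, hp⟩, hr⟩, hc⟩, hy⟩, hn⟩, hm⟩
      ⟨⟨⟨⟨⟨⟨⟨⟨⟨h', h12', h1'⟩, rfl⟩, rfl⟩, rfl⟩, rfl⟩, rfl⟩, rfl⟩, rfl⟩, rfl⟩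
    have hmn : 2 * s.m * s.n ≠ 0 := mul_ne_zero (mul_ne_zero two_ne_zero h'.m0) h'.n0
    unfold Q1 at h1 h1'
    unfold Q12 at h12 h12'
    have hq := h.hq
    have hq' := h'.hq
    rw [ha, hd, hn, hm] at h1
    rw [hp, hr, hn, hm] at h12
    have hx : t.x = s.x := by
      apply mul_left_cancel₀ hmn; linear_combination h1 - h1'
    have hz : t.z = s.z := by
      apply mul_left_cancel₀ hmn; linear_combination h12' - h12
    rw [ha, hd, hc, hx, hy, hp, hr, hz] at hq
    have he : t.e = s.e := by
      apply mul_left_cancel₀ h'.a0; linear_combination hq - hq'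
    exact pr_eq ha hx hd hc hy he hp hz hr
  refine this.mono (fun t h => h) ?_
  have : 0 ≤ T ^ 18 * D ^ 2 := Nat.zero_le _
  ring_nf
  nlinarith

theorem pieceW {T D : ℕ} (hT : 1 ≤ T) (HD : DivB T D) :
    Cn (fun t => Gen T t ∧ t.Q12 ≠ 0 ∧ t.n * t.x + t.m * t.a = 0) (10000 * T ^ 18 * D ^ 2) := by
  have hT3 : 1 ≤ T ^ 3 := Nat.one_le_pow _ _ hT
  have : Cn (fun t => Gen T t ∧ t.Q12 ≠ 0 ∧ t.n * t.x + t.m * t.a = 0)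
      (3 * T ^ 3 * (3 * T ^ 3 * (3 * T ^ 3 * (3 * T ^ 3 * (3 * T ^ 3 * (3 * T ^ 3 * (D * (D * 1)))))))) := by
    refine Cn.box hT3 (fun t => t.a) (fun t ht => by exact_mod_cast ht.1.ha) fun a0 => ?_
    refine Cn.box hT3 (fun t => t.x) (fun t ht => by exact_mod_cast ht.1.1.hx) fun x0 => ?_
    refine Cn.box hT3 (fun t => t.p) (fun t ht => by exact_mod_cast ht.1.1.1.hp) fun p0 => ?_
    refine Cn.box hT3 (fun t => t.r) (fun t ht => by exact_mod_cast ht.1.1.1.1.hr) fun r0 => ?_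
    refine Cn.box hT3 (fun t => t.z) (fun t ht => by exact_mod_cast ht.1.1.1.1.1.hz) fun z0 => ?_
    refine Cn.box hT3 (fun t => t.y) (fun t ht => by exact_mod_cast ht.1.1.1.1.1.1.hy) fun y0 => ?_
    refine Cn.dvd HD (fun t => t.n) a0 ?_ ?_ ?_ fun n0 => ?_
    · rintro t ⟨⟨⟨⟨⟨⟨⟨h, h12, h1⟩, rfl⟩, rfl⟩, rfl⟩, rfl⟩, rfl⟩, rfl⟩
      have : t.n ∣ t.a * t.m := ⟨-t.x, by linear_combination h1⟩
      exact h.hcop.symm.dvd_of_dvd_mul_right this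
    · rintro t ⟨⟨⟨⟨⟨⟨⟨h, h12, h1⟩, rfl⟩, rfl⟩, rfl⟩, rfl⟩, rfl⟩, rfl⟩
      exact h.a0
    · rintro t ⟨⟨⟨⟨⟨⟨⟨h, h12, h1⟩, rfl⟩, rfl⟩, rfl⟩, rfl⟩, rfl⟩, rfl⟩
      exact h.ha.trans (T3_le hT)
    apply Cn.base
    rintro s ⟨⟨⟨⟨⟨⟨⟨⟨h', h12', h1'⟩, rfl⟩, rfl⟩, rfl⟩, rfl⟩, rfl⟩, rfl⟩, rfl⟩
    have key : ∀ t : Tup, t.n * t.x + t.m * t.a = 0 → t.a = s.a → t.x = s.x → t.n = s.n →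
        t.p = s.p → t.r = s.r → t.z = s.z → t.m = s.m ∧ t.Q12 = s.Q12 := by
      intro t h1 ha hx hn hp hr hz
      have hm : t.m = s.m := by
        rw [ha, hx, hn] at h1
        apply mul_right_cancel₀ h'.a0; linear_combination h1 - h1'
      exact ⟨hm, by unfold Q12; rw [hm, hn, hp, hr, hz]⟩
    refine Cn.dvd HD Tup.Q1 (s.Q12 ^ 2) ?_ ?_ ?_ fun v0 => ?_
    · rintro t ⟨⟨⟨⟨⟨⟨⟨⟨h, h12, h1⟩, ha⟩, hx⟩, hp⟩, hr⟩, hz⟩, hy⟩, hn⟩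
      rw [← (key t h1 ha hx hn hp hr hz).2]
      exact ⟨_, h.hg⟩
    · exact fun _ _ => pow_ne_zero _ h12'
    · exact fun _ _ => h'.Q12sq_le
    clear key h1' h12' h'
    apply Cn.single
    rintro t s ⟨⟨⟨⟨⟨⟨⟨⟨⟨h, h12, h1⟩, ha⟩, hx⟩, hp⟩, hr⟩, hz⟩, hy⟩, hn⟩, hQ⟩
      ⟨⟨⟨⟨⟨⟨⟨⟨⟨h', h12', h1'⟩, ha'⟩, hx'⟩, hp'⟩, hr'⟩, hz'⟩, hy'⟩, hn'⟩, hQ'⟩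
    replace ha := ha.trans ha'.symm
    replace hx := hx.trans hx'.symm
    replace hp := hp.trans hp'.symm
    replace hr := hr.trans hr'.symm
    replace hz := hz.trans hz'.symm
    replace hy := hy.trans hy'.symm
    replace hn := hn.trans hn'.symm
    replace hQ := hQ.trans hQ'.symm
    have hm : t.m = s.m := by
      rw [ha, hx, hn] at h1
      apply mul_right_cancel₀ h'.a0; linear_combination h1 - h1'
    have h12e : t.Q12 = s.Q12 := by unfold Q12; rw [hm, hn, hp, hr, hz]
    have hQ1 : s.Q1 ≠ 0 := by
      intro h0
      have := h'.hg
      rw [h0, zero_mul] at this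
      exact h12' (pow_eq_zero_iff (two_ne_zero) |>.1 this)
    have hQ2 : t.Q2 = s.Q2 := by
      apply mul_left_cancel₀ hQ1
      rw [← h'.hg, ← hQ, ← h.hg, h12e]
    have w := identW t
    have w' := identW s
    rw [h.hq, h1] at w
    rw [h'.hq, h1'] at w'
    rw [ha, hQ, hQ2, hn, hp, hr, hz] at w
    have hc : t.c = s.c := by
      apply mul_right_cancel₀ hQ1; linear_combination w' - w
    have hn2 : s.n ^ 2 ≠ 0 := pow_ne_zero _ h'.n0
    have hd : t.d = s.d := by
      unfold Q1 at hQ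
      rw [hm, hn, ha, hx] at hQ
      apply mul_left_cancel₀ hn2; linear_combination hQ
    have he : t.e = s.e := by
      unfold Q2 at hQ2
      rw [hm, hn, hc, hy] at hQ2
      apply mul_left_cancel₀ hn2; linear_combination hQ2
    exact pr_eq ha hx hd hc hy he hp hz hr
  refine this.mono (fun t h => h) ?_
  have : 0 ≤ T ^ 18 * D ^ 2 := Nat.zero_le _
  ring_nf
  nlinarith

theorem pieceI {T D : ℕ} (hT : 1 ≤ T) (HD : DivB T D) :
    Cn (fun t => Gen T t ∧ t.Q12 ≠ 0 ∧ t.n * t.x + t.m * t.a ≠ 0 ∧ t.n * t.y - t.m * t.c ≠ 0 ∧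
      |t.m| ≤ (T : ℤ) ^ 5) (10000 * T ^ 20 * D ^ 3) := by
  have hT3 : 1 ≤ T ^ 3 := Nat.one_le_pow _ _ hT
  have hT5 : 1 ≤ T ^ 5 := Nat.one_le_pow _ _ hT
  have : Cn (fun t => Gen T t ∧ t.Q12 ≠ 0 ∧ t.n * t.x + t.m * t.a ≠ 0 ∧ t.n * t.y - t.m * t.c ≠ 0 ∧
      |t.m| ≤ (T : ℤ) ^ 5)
      (3 * T ^ 3 * (3 * T ^ 3 * (3 * T ^ 3 * (3 * T ^ 3 * (3 * T ^ 3 * (3 * T ^ 5 *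
        (D * (D * (D * 1))))))))) := by
    refine Cn.box hT3 (fun t => t.a) (fun t ht => by exact_mod_cast ht.1.ha) fun a0 => ?_
    refine Cn.box hT3 (fun t => t.c) (fun t ht => by exact_mod_cast ht.1.1.hc) fun c0 => ?_
    refine Cn.box hT3 (fun t => t.p) (fun t ht => by exact_mod_cast ht.1.1.1.hp) fun p0 => ?_
    refine Cn.box hT3 (fun t => t.r) (fun t ht => by exact_mod_cast ht.1.1.1.1.hr) fun r0 => ?_
    refine Cn.box hT3 (fun t => t.z) (fun t ht => by exact_mod_cast ht.1.1.1.1.1.hz) fun z0 => ?_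
    refine Cn.box hT5 (fun t => t.m) (fun t ht => by
      exact_mod_cast ht.1.1.1.1.1.2.2.2.2) fun m0 => ?_
    refine Cn.dvd HD (fun t => t.n) (p0 ^ 2 - a0 * c0) ?_ ?_ ?_ fun n0 => ?_
    · rintro t ⟨⟨⟨⟨⟨⟨⟨h, _⟩, rfl⟩, rfl⟩, rfl⟩, rfl⟩, rfl⟩, rfl⟩
      exact h.n_dvd
    · rintro t ⟨⟨⟨⟨⟨⟨⟨h, _⟩, rfl⟩, rfl⟩, rfl⟩, rfl⟩, rfl⟩, rfl⟩
      exact h.g0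
    · rintro t ⟨⟨⟨⟨⟨⟨⟨h, _⟩, rfl⟩, rfl⟩, rfl⟩, rfl⟩, rfl⟩, rfl⟩
      exact h.g0_le.trans (T6_le hT)
    refine Cn.dvd HD Tup.Q1 ((m0 ^ 2 * p0 - 2 * m0 * n0 * z0 - n0 ^ 2 * r0) ^ 2) ?_ ?_ ?_ fun v0 => ?_
    · rintro t ⟨⟨⟨⟨⟨⟨⟨⟨h, h12, _⟩, rfl⟩, rfl⟩, rfl⟩, rfl⟩, rfl⟩, rfl⟩, rfl⟩
      exact ⟨_, h.hg⟩
    · rintro t ⟨⟨⟨⟨⟨⟨⟨⟨h, h12, _⟩, rfl⟩, rfl⟩, rfl⟩, rfl⟩, rfl⟩, rfl⟩, rfl⟩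
      exact pow_ne_zero _ h12
    · rintro t ⟨⟨⟨⟨⟨⟨⟨⟨h, h12, _⟩, rfl⟩, rfl⟩, rfl⟩, rfl⟩, rfl⟩, rfl⟩, rfl⟩
      exact h.Q12sq_le
    apply Cn.base
    rintro s ⟨⟨⟨⟨⟨⟨⟨⟨⟨h', h12', hU', hV', hM'⟩, rfl⟩, rfl⟩, rfl⟩, rfl⟩, rfl⟩, rfl⟩, rfl⟩, rfl⟩
    have hQ1 : s.Q1 ≠ 0 := by
      intro h0
      have := h'.hg
      rw [h0, zero_mul] at this
      exact h12' (pow_eq_zero_iff (two_ne_zero) |>.1 this)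
    have key : ∀ t : Tup, Good T t → t.Q1 = s.Q1 → t.a = s.a → t.c = s.c → t.n = s.n → t.m = s.m →
        t.p = s.p → t.r = s.r → t.z = s.z → t.Q2 = s.Q2 ∧
        (t.n * t.x + t.m * t.a) * (t.n * t.y - t.m * t.c) =
        (s.n * s.x + s.m * s.a) * (s.n * s.y - s.m * s.c) := by
      intro t h hQ ha hc hn hm hp hr hz
      have h12e : t.Q12 = s.Q12 := by unfold Q12; rw [hm, hn, hp, hr, hz]
      have hQ2 : t.Q2 = s.Q2 := by
        apply mul_left_cancel₀ hQ1
        rw [← h'.hg, ← hQ, ← h.hg, h12e]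
      refine ⟨hQ2, ?_⟩
      have w := identW t
      have w' := identW s
      rw [h.hq, ha, hQ, hQ2, hn, hp, hr, hz, hc] at w
      rw [h'.hq] at w'
      rw [ha, hn, hc]
      apply mul_left_cancel₀ (two_ne_zero (α := ℤ))
      linear_combination w' - w
    refine Cn.dvd HD (fun t => t.n * t.x + t.m * t.a)
      ((s.n * s.x + s.m * s.a) * (s.n * s.y - s.m * s.c)) ?_ ?_ ?_ fun U0 => ?_
    · rintro t ⟨⟨⟨⟨⟨⟨⟨⟨⟨h, _⟩, ha⟩, hc⟩, hp⟩, hr⟩, hz⟩, hm⟩, hn⟩, hQ⟩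
      exact ⟨_, (key t h.toGood hQ ha hc hn hm hp hr hz).2.symm⟩
    · exact fun _ _ => mul_ne_zero hU' hV'
    · intro _ _
      have b1 := abs_add_le' (abs_mul_le h'.n_le h'.hx) (abs_mul_le h'.m_le h'.ha)
      have b2 := abs_sub_le' (abs_mul_le h'.n_le h'.hy) (abs_mul_le h'.m_le h'.hc)
      refine (abs_mul_le b1 b2).trans ?_
      have := pow_le_T30 hT (j := 18) (by norm_num) 16 (by norm_num) (by norm_num)
      refine le_trans (le_of_eq ?_) this
      ring
    · apply Cn.single
      have det : ∀ t, ((((((((((Gen T t ∧ t.Q12 ≠ 0 ∧ t.n * t.x + t.m * t.a ≠ 0 ∧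
          t.n * t.y - t.m * t.c ≠ 0 ∧ |t.m| ≤ (T : ℤ) ^ 5) ∧ t.a = s.a) ∧ t.c = s.c) ∧ t.p = s.p) ∧
          t.r = s.r) ∧ t.z = s.z) ∧ t.m = s.m) ∧ t.n = s.n) ∧ t.Q1 = s.Q1) ∧
          t.n * t.x + t.m * t.a = U0) →
          s.n * t.x + s.m * s.a = U0 ∧ U0 ≠ 0 ∧ U0 * (s.n * t.y - s.m * s.c) =
            (s.n * s.x + s.m * s.a) * (s.n * s.y - s.m * s.c) ∧
          s.m ^ 2 * s.a + 2 * s.m * s.n * t.x + s.n ^ 2 * t.d = s.Q1 ∧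
          s.m ^ 2 * s.c - 2 * s.m * s.n * t.y + s.n ^ 2 * t.e = s.Q2 := by
        rintro t ⟨⟨⟨⟨⟨⟨⟨⟨⟨⟨h, h12, hU, hV, hM⟩, ha⟩, hc⟩, hp⟩, hr⟩, hz⟩, hm⟩, hn⟩, hQ⟩, hU0⟩
        obtain ⟨k1, k2⟩ := key t h.toGood hQ ha hc hn hm hp hr hz
        rw [hU0] at hU k2
        unfold Q1 at hQ
        unfold Q2 at k1
        rw [ha, hn, hm] at hQ hU0
        rw [hc, hn, hm] at k2 k1
        exact ⟨hU0, hU, k2, hQ, k1⟩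
      intro t t' ht ht'
      obtain ⟨i1, i2, i3, i4, i5⟩ := det t ht
      obtain ⟨j1, j2, j3, j4, j5⟩ := det t' ht'
      obtain ⟨⟨⟨⟨⟨⟨⟨⟨⟨_, ha⟩, hc⟩, hp⟩, hr⟩, hz⟩, hm⟩, hn⟩, hQ⟩, hU0⟩ := ht
      obtain ⟨⟨⟨⟨⟨⟨⟨⟨⟨_, ha'⟩, hc'⟩, hp'⟩, hr'⟩, hz'⟩, hm'⟩, hn'⟩, hQ'⟩, hU0'⟩ := ht'
      have hn2 : s.n ^ 2 ≠ 0 := pow_ne_zero _ h'.n0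
      have hx : t.x = t'.x := by
        apply mul_left_cancel₀ h'.n0; linear_combination i1 - j1
      have hy : t.y = t'.y := by
        apply mul_left_cancel₀ (mul_ne_zero i2 h'.n0); linear_combination i3 - j3
      have hd : t.d = t'.d := by
        rw [hx] at i4
        apply mul_left_cancel₀ hn2; linear_combination i4 - j4
      have he : t.e = t'.e := by
        rw [hy] at i5
        apply mul_left_cancel₀ hn2; linear_combination i5 - j5
      exact pr_eq (ha.trans ha'.symm) hx hd (hc.trans hc'.symm) hy he (hp.trans hp'.symm)
        (hz.trans hz'.symm) (hr.trans hr'.symm)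
  refine this.mono (fun t h => h) ?_
  have : 0 ≤ T ^ 20 * D ^ 3 := Nat.zero_le _
  ring_nf
  nlinarith

open Tup

def Tup.L1 (t : Tup) : ℤ := -2 * t.p * t.z + t.a * t.y - t.x * t.c
def Tup.L3 (t : Tup) : ℤ := 2 * t.z * t.r + t.d * t.y - t.x * t.e

theorem Tup.Good.L1_le {T : ℕ} {t : Tup} (h : Good T t) : |t.L1| ≤ 4 * (T : ℤ) ^ 6 := by
  unfold L1
  have b1 := abs_mul_le (abs_mul_le (le_refl |(-2 : ℤ)|) h.hp) h.hz
  refine (abs_sub_le' (abs_add_le' b1 (abs_mul_le h.ha h.hy)) (abs_mul_le h.hx h.hc)).trans ?_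
  rw [abs_neg, abs_two]
  apply le_of_eq; ring

theorem Tup.Good.L3_le {T : ℕ} {t : Tup} (h : Good T t) : |t.L3| ≤ 4 * (T : ℤ) ^ 6 := by
  unfold L3
  have b1 := abs_mul_le (abs_mul_le (le_refl |(2 : ℤ)|) h.hz) h.hr
  refine (abs_sub_le' (abs_add_le' b1 (abs_mul_le h.hd h.hy)) (abs_mul_le h.hx h.he)).trans ?_
  rw [abs_two]
  apply le_of_eq; ring

theorem quot_le {T : ℕ} {m u v j : ℤ} (hm : (T : ℤ) ^ 5 < |m|) (hu : |u| ≤ 4 * (T : ℤ) ^ 6)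
    (hv : |v| ≤ 4 * (T : ℤ) ^ 6) (h : 2 * u - 2 * v = m * j) : |j| ≤ ((16 * T : ℕ) : ℤ) := by
  have h1 : |m * j| ≤ 16 * (T : ℤ) ^ 6 := by
    rw [← h, ← mul_sub, abs_mul, abs_two]
    have := abs_sub_le' hu hv
    linarith
  rw [abs_mul] at h1
  push_cast
  by_contra hc
  push Not at hc
  have h5 : (0 : ℤ) ≤ (T : ℤ) ^ 5 := by positivity
  have h16 : (0 : ℤ) ≤ 16 * (T : ℤ) := by positivity
  have : (T : ℤ) ^ 5 * (16 * T) < |m| * |j| := mul_lt_mul'' hm hc h5 h16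
  have e : (T : ℤ) ^ 5 * (16 * T) = 16 * (T : ℤ) ^ 6 := by ring
  linarith

theorem congr_L3 {T : ℕ} {t s : Tup} (h : Gen T t) (h' : Gen T s) (ha : t.a = s.a) (hd : t.d = s.d)
    (hc : t.c = s.c) (he : t.e = s.e) (hp : t.p = s.p) (hr : t.r = s.r) (hm : t.m = s.m)
    (hn : t.n = s.n) : s.m ∣ 2 * t.L3 - 2 * s.L3 := by
  have k := h.quartic
  have k' := h'.quartic
  have eL3 : (2 * t.z * t.r + t.d * t.y - t.x * t.e) = t.L3 := rfl
  have eL3' : (2 * s.z * s.r + s.d * s.y - s.x * s.e) = s.L3 := rfl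
  rw [eL3, ha, hd, hc, he, hp, hr, hm, hn] at k
  rw [eL3'] at k'
  have : s.m ∣ (2 * t.L3 - 2 * s.L3) * s.n ^ 3 := by
    refine ⟨-((2 * (-2 * s.p * t.z + s.a * t.y - t.x * s.c) -
        2 * (-2 * s.p * s.z + s.a * s.y - s.x * s.c)) * s.m * s.n
      + (6 * (t.x * t.y + t.z ^ 2) - 6 * (s.x * s.y + s.z ^ 2)) * s.n ^ 2), ?_⟩
    apply mul_left_cancel₀ h'.m0
    linear_combination k - k'
  exact (h'.hcop.pow_right (n := 3)).dvd_of_dvd_mul_right this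

theorem congr_L1 {T : ℕ} {t s : Tup} (h : Gen T t) (h' : Gen T s) (ha : t.a = s.a) (hd : t.d = s.d)
    (hc : t.c = s.c) (he : t.e = s.e) (hp : t.p = s.p) (hr : t.r = s.r) (hm : t.m = s.m)
    (hn : t.n = s.n) : s.n ∣ 2 * t.L1 - 2 * s.L1 := by
  have := congr_L3 h.s2 h'.s2 (t := s2 t) (s := s2 s) hd ha he hc (by simp [s2, hr])
    (by simp [s2, hp]) hn hm
  have e : ∀ t : Tup, (s2 t).L3 = t.L1 := by
    intro t; simp only [s2, L3, L1]; ring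
  rw [e, e] at this
  exact this

set_option maxHeartbeats 1000000 in
theorem pieceII {T D : ℕ} (hT : 1 ≤ T) (HD : DivB T D) :
    Cn (fun t => Gen T t ∧ (T : ℤ) ^ 5 < |t.m| ∧ (T : ℤ) ^ 5 < |t.n|)
      (10000000 * T ^ 20 * D ^ 2) := by
  have hT3 : 1 ≤ T ^ 3 := Nat.one_le_pow _ _ hT
  have hT16 : 1 ≤ 16 * T := by omega
  have : Cn (fun t => Gen T t ∧ (T : ℤ) ^ 5 < |t.m| ∧ (T : ℤ) ^ 5 < |t.n|)
      (3 * T ^ 3 * (3 * T ^ 3 * (3 * T ^ 3 * (3 * T ^ 3 * (3 * T ^ 3 * (3 * T ^ 3 *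
        (D * (D * (3 * (16 * T) * (3 * (16 * T) * (2 * 1 + 2 * 1))))))))))) := by
    refine Cn.box hT3 (fun t => t.a) (fun t ht => by exact_mod_cast ht.1.ha) fun a0 => ?_
    refine Cn.box hT3 (fun t => t.c) (fun t ht => by exact_mod_cast ht.1.1.hc) fun c0 => ?_
    refine Cn.box hT3 (fun t => t.p) (fun t ht => by exact_mod_cast ht.1.1.1.hp) fun p0 => ?_
    refine Cn.box hT3 (fun t => t.r) (fun t ht => by exact_mod_cast ht.1.1.1.1.hr) fun r0 => ?_
    refine Cn.box hT3 (fun t => t.d) (fun t ht => by exact_mod_cast ht.1.1.1.1.1.hd) fun d0 => ?_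
    refine Cn.box hT3 (fun t => t.e) (fun t ht => by exact_mod_cast ht.1.1.1.1.1.1.he) fun e0 => ?_
    refine Cn.dvd HD (fun t => t.n) (p0 ^ 2 - a0 * c0) ?_ ?_ ?_ fun n0 => ?_
    · rintro t ⟨⟨⟨⟨⟨⟨⟨h, _⟩, rfl⟩, rfl⟩, rfl⟩, rfl⟩, rfl⟩, rfl⟩
      exact h.n_dvd
    · rintro t ⟨⟨⟨⟨⟨⟨⟨h, _⟩, rfl⟩, rfl⟩, rfl⟩, rfl⟩, rfl⟩, rfl⟩
      exact h.g0
    · rintro t ⟨⟨⟨⟨⟨⟨⟨h, _⟩, rfl⟩, rfl⟩, rfl⟩, rfl⟩, rfl⟩, rfl⟩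
      exact h.g0_le.trans (T6_le hT)
    refine Cn.dvd HD (fun t => t.m) (r0 ^ 2 - d0 * e0) ?_ ?_ ?_ fun m0 => ?_
    · rintro t ⟨⟨⟨⟨⟨⟨⟨⟨h, _⟩, rfl⟩, rfl⟩, rfl⟩, rfl⟩, rfl⟩, rfl⟩, rfl⟩
      exact h.m_dvd
    · rintro t ⟨⟨⟨⟨⟨⟨⟨⟨h, _⟩, rfl⟩, rfl⟩, rfl⟩, rfl⟩, rfl⟩, rfl⟩, rfl⟩
      exact h.g4
    · rintro t ⟨⟨⟨⟨⟨⟨⟨⟨h, _⟩, rfl⟩, rfl⟩, rfl⟩, rfl⟩, rfl⟩, rfl⟩, rfl⟩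
      exact h.g4_le.trans (T6_le hT)
    refine Cn.near hT16 (fun t => 2 * t.L3) m0 ?_ fun l3 => ?_
    · rintro t s ⟨⟨⟨⟨⟨⟨⟨⟨⟨h, hm5, hn5⟩, ha⟩, hc⟩, hp⟩, hr⟩, hd⟩, he⟩, hn⟩, hm⟩
        ⟨⟨⟨⟨⟨⟨⟨⟨⟨h', hm5', hn5'⟩, rfl⟩, rfl⟩, rfl⟩, rfl⟩, rfl⟩, rfl⟩, rfl⟩, rfl⟩
      obtain ⟨j, hj⟩ := congr_L3 h h' ha hd hc he hp hr hm hn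
      exact ⟨j, hj, quot_le hm5' h.L3_le h'.L3_le hj⟩
    refine Cn.near hT16 (fun t => 2 * t.L1) n0 ?_ fun l1 => ?_
    · rintro t s ⟨⟨⟨⟨⟨⟨⟨⟨⟨⟨h, hm5, hn5⟩, ha⟩, hc⟩, hp⟩, hr⟩, hd⟩, he⟩, hn⟩, hm⟩, _⟩
        ⟨⟨⟨⟨⟨⟨⟨⟨⟨⟨h', hm5', hn5'⟩, rfl⟩, rfl⟩, rfl⟩, rfl⟩, rfl⟩, rfl⟩, rfl⟩, rfl⟩, _⟩
      obtain ⟨j, hj⟩ := congr_L1 h h' ha hd hc he hp hr hm hn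
      exact ⟨j, hj, quot_le hn5' h.L1_le h'.L1_le hj⟩
    apply Cn.base
    rintro s ⟨⟨⟨⟨⟨⟨⟨⟨⟨⟨⟨h', hm5', hn5'⟩, rfl⟩, rfl⟩, rfl⟩, rfl⟩, rfl⟩, rfl⟩, rfl⟩, rfl⟩, rfl⟩, rfl⟩
    -- the final two-dimensional problem
    set G : Tup → Prop := fun t => (t.a = s.a ∧ t.c = s.c ∧ t.p = s.p ∧ t.r = s.r ∧ t.d = s.d ∧
      t.e = s.e) ∧ (2 * t.z * s.r + s.d * t.y - t.x * s.e = s.L3) ∧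
      (-2 * s.p * t.z + s.a * t.y - t.x * s.c = s.L1) ∧
      (t.x * t.y + t.z ^ 2 = s.x * s.y + s.z ^ 2) with hG
    set X := -2 * s.d * s.p - 2 * s.r * s.a with hX
    set Y := -2 * s.r * s.c - 2 * s.e * s.p with hY
    set Z := s.d * s.c - s.e * s.a with hZ
    have hR : X * Y + Z ^ 2 ≠ 0 := by
      have := h'.R0
      unfold Tup.R at this
      convert this using 1
      rw [hX, hY, hZ]; ring
    -- elimination identities
    set α := -2 * s.p * s.L3 - 2 * s.r * s.L1 with hα
    set β := s.d * s.L1 - s.a * s.L3 with hβ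
    set γ := s.e * s.L1 - s.c * s.L3 with hγ
    have E1 : ∀ t, G t → X * t.y = Y * t.x + α := by
      rintro t ⟨_, h3, h1, _⟩
      rw [hα, ← h3, ← h1, hX, hY]; ring
    have E2 : ∀ t, G t → X * t.z = Z * t.x + β := by
      rintro t ⟨_, h3, h1, _⟩
      rw [hβ, ← h3, ← h1, hX, hZ]; ring
    have E3 : ∀ t, G t → Y * t.z = Z * t.y + γ := by
      rintro t ⟨_, h3, h1, _⟩
      rw [hγ, ← h3, ← h1, hY, hZ]; ring
    have c1 : Cn (fun t => G t ∧ X ≠ 0) (2 * 1) := by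
      refine Cn.quad (fun t => t.x) (X * Y + Z ^ 2) (X * α + 2 * Z * β)
        (β ^ 2 - X ^ 2 * (s.x * s.y + s.z ^ 2)) (fun _ _ => hR) ?_ ?_
      · rintro t ⟨g, _⟩
        have e1 := E1 t g
        have e2 := E2 t g
        have e4 := g.2.2.2
        linear_combination X ^ 2 * e4 - X * t.x * e1 - (X * t.z + Z * t.x + β) * e2
      · intro v
        apply Cn.single
        rintro t t' ⟨⟨g, hX0⟩, hv⟩ ⟨⟨g', _⟩, hv'⟩
        have hx : t.x = t'.x := hv.trans hv'.symm
        have hy : t.y = t'.y := by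
          apply mul_left_cancel₀ hX0
          rw [E1 t g, E1 t' g', hx]
        have hz : t.z = t'.z := by
          apply mul_left_cancel₀ hX0
          rw [E2 t g, E2 t' g', hx]
        obtain ⟨⟨i1, i2, i3, i4, i5, i6⟩, _⟩ := g
        obtain ⟨⟨j1, j2, j3, j4, j5, j6⟩, _⟩ := g'
        exact pr_eq (i1.trans j1.symm) hx (i5.trans j5.symm) (i2.trans j2.symm) hy
          (i6.trans j6.symm) (i3.trans j3.symm) hz (i4.trans j4.symm)
    have c2 : Cn (fun t => G t ∧ Z ≠ 0) (2 * 1) := by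
      refine Cn.quad (fun t => t.z) (X * Y + Z ^ 2) (-(β * Y + γ * X))
        (β * γ - Z ^ 2 * (s.x * s.y + s.z ^ 2)) (fun _ _ => hR) ?_ ?_
      · rintro t ⟨g, _⟩
        have e2 := E2 t g
        have e3 := E3 t g
        have e4 := g.2.2.2
        linear_combination Z ^ 2 * e4 + (Y * t.z - γ) * e2 + Z * t.x * e3
      · intro v
        apply Cn.single
        rintro t t' ⟨⟨g, hX0⟩, hv⟩ ⟨⟨g', _⟩, hv'⟩
        have hz : t.z = t'.z := hv.trans hv'.symm
        have hx : t.x = t'.x := by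
          apply mul_left_cancel₀ hX0
          have i := E2 t g
          rw [hz, E2 t' g'] at i
          linarith
        have hy : t.y = t'.y := by
          apply mul_left_cancel₀ hX0
          have i := E3 t g
          rw [hz, E3 t' g'] at i
          linarith
        obtain ⟨⟨i1, i2, i3, i4, i5, i6⟩, _⟩ := g
        obtain ⟨⟨j1, j2, j3, j4, j5, j6⟩, _⟩ := g'
        exact pr_eq (i1.trans j1.symm) hx (i5.trans j5.symm) (i2.trans j2.symm) hy
          (i6.trans j6.symm) (i3.trans j3.symm) hz (i4.trans j4.symm)
    refine (c1.or c2).mono ?_ le_rfl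
    rintro t ⟨⟨⟨⟨⟨⟨⟨⟨⟨⟨⟨h, hm5, hn5⟩, ha⟩, hc⟩, hp⟩, hr⟩, hd⟩, he⟩, hn⟩, hm⟩, h3⟩, h1⟩
    have g : G t := by
      refine ⟨⟨ha, hc, hp, hr, hd, he⟩, ?_, ?_, ?_⟩
      · have : t.L3 = s.L3 := mul_left_cancel₀ two_ne_zero h3
        rw [← this, L3, hr, hd, he]
      · have : t.L1 = s.L1 := mul_left_cancel₀ two_ne_zero h1
        rw [← this, L1, hp, ha, hc]
      · have q := h.hq
        have q' := h'.hq
        rw [ha, hc, hp, hr, hd, he] at q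
        apply mul_left_cancel₀ (two_ne_zero (α := ℤ))
        linear_combination q - q'
    by_cases hX0 : X = 0
    · right
      refine ⟨g, fun hZ0 => hR ?_⟩
      rw [hX0, hZ0]; ring
    · exact Or.inl ⟨g, hX0⟩
  refine this.mono (fun t h => h) ?_
  have : 0 ≤ T ^ 20 * D ^ 2 := Nat.zero_le _
  ring_nf
  nlinarith

theorem gen_count {T D : ℕ} (hT : 1 ≤ T) (hD : 1 ≤ D) (HD : DivB T D) :
    Cn (Gen T) (20000000 * T ^ 20 * D ^ 3) := by
  have z1 := pieceZ hT HD
  have z2 : Cn (fun t => Gen T t ∧ t.Q12 = 0 ∧ t.Q2 = 0) (10000 * T ^ 18 * D ^ 2) := by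
    refine z1.s1 ?_
    rintro t ⟨h, h12, h2⟩
    refine ⟨h.s1, h12, ?_⟩
    rw [← h2]
    simp only [s1, Q1, Q2]; ring
  have w1 := pieceW hT HD
  have w2 : Cn (fun t => Gen T t ∧ t.Q12 ≠ 0 ∧ t.n * t.y - t.m * t.c = 0)
      (10000 * T ^ 18 * D ^ 2) := by
    refine w1.s1 ?_
    rintro t ⟨h, h12, h2⟩
    refine ⟨h.s1, h12, ?_⟩
    simp only [s1]; linear_combination -h2
  have i1 := pieceI hT HD
  have i2 : Cn (fun t => Gen T t ∧ t.Q12 ≠ 0 ∧ t.m * t.x + t.n * t.d ≠ 0 ∧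
      t.m * t.y - t.n * t.e ≠ 0 ∧ |t.n| ≤ (T : ℤ) ^ 5) (10000 * T ^ 20 * D ^ 3) := by
    refine i1.s2 ?_
    rintro t ⟨h, h12, hU, hV, hn⟩
    refine ⟨h.s2, ?_, hU, hV, hn⟩
    convert h12 using 1
    simp only [s2, Q12]; ring
  have w3 : Cn (fun t => Gen T t ∧ t.Q12 ≠ 0 ∧ t.m * t.x + t.n * t.d = 0)
      (10000 * T ^ 18 * D ^ 2) := by
    refine w1.s2 ?_
    rintro t ⟨h, h12, h2⟩
    refine ⟨h.s2, ?_, h2⟩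
    convert h12 using 1
    simp only [s2, Q12]; ring
  have w4 : Cn (fun t => Gen T t ∧ t.Q12 ≠ 0 ∧ t.m * t.y - t.n * t.e = 0)
      (10000 * T ^ 18 * D ^ 2) := by
    refine w2.s2 ?_
    rintro t ⟨h, h12, h2⟩
    refine ⟨h.s2, ?_, h2⟩
    convert h12 using 1
    simp only [s2, Q12]; ring
  have ii := pieceII hT HD
  refine (z1.or (z2.or (w1.or (w2.or (w3.or (w4.or (i1.or (i2.or ii)))))))).mono ?_ ?_
  · intro t h
    by_cases h12 : t.Q12 = 0
    · have := h.hg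
      rw [h12] at this
      have : t.Q1 * t.Q2 = 0 := by rw [← this]; ring
      rcases mul_eq_zero.1 this with h1 | h1
      · exact Or.inl ⟨h, h12, h1⟩
      · exact Or.inr (Or.inl ⟨h, h12, h1⟩)
    by_cases a1 : t.n * t.x + t.m * t.a = 0
    · exact Or.inr (Or.inr (Or.inl ⟨h, h12, a1⟩))
    by_cases a2 : t.n * t.y - t.m * t.c = 0
    · exact Or.inr (Or.inr (Or.inr (Or.inl ⟨h, h12, a2⟩)))
    by_cases a3 : t.m * t.x + t.n * t.d = 0
    · exact Or.inr (Or.inr (Or.inr (Or.inr (Or.inl ⟨h, h12, a3⟩))))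
    by_cases a4 : t.m * t.y - t.n * t.e = 0
    · exact Or.inr (Or.inr (Or.inr (Or.inr (Or.inr (Or.inl ⟨h, h12, a4⟩)))))
    by_cases a5 : |t.m| ≤ (T : ℤ) ^ 5
    · exact Or.inr (Or.inr (Or.inr (Or.inr (Or.inr (Or.inr (Or.inl ⟨h, h12, a1, a2, a5⟩))))))
    by_cases a6 : |t.n| ≤ (T : ℤ) ^ 5
    · exact Or.inr (Or.inr (Or.inr (Or.inr (Or.inr (Or.inr (Or.inr (Or.inl ⟨h, h12, a3, a4, a6⟩)))))))
    · exact Or.inr (Or.inr (Or.inr (Or.inr (Or.inr (Or.inr (Or.inr (Or.inr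
        ⟨h, not_le.1 a5, not_le.1 a6⟩)))))))
  · have k1 : T ^ 18 * D ^ 2 ≤ T ^ 20 * D ^ 3 :=
      Nat.mul_le_mul (Nat.pow_le_pow_right hT (by norm_num)) (Nat.pow_le_pow_right hD (by norm_num))
    have k2 : T ^ 20 * D ^ 2 ≤ T ^ 20 * D ^ 3 :=
      Nat.mul_le_mul le_rfl (Nat.pow_le_pow_right hD (by norm_num))
    have k3 : 0 ≤ T ^ 20 * D ^ 3 := Nat.zero_le _
    linarith

theorem good_count {T D : ℕ} (hT : 1 ≤ T) (hD : 1 ≤ D) (HD : DivB T D) :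
    Cn (Good T) (30000000 * T ^ 20 * D ^ 3) := by
  have a1 := bad_a hT hD HD
  have a2 : Cn (fun t => Good T t ∧ t.c = 0) (10000 * T ^ 18 * D) :=
    a1.s1 (fun t h => ⟨h.1.s1, h.2⟩)
  have a3 : Cn (fun t => Good T t ∧ t.d = 0) (10000 * T ^ 18 * D) :=
    a1.s2 (fun t h => ⟨h.1.s2, h.2⟩)
  have a4 : Cn (fun t => Good T t ∧ t.e = 0) (10000 * T ^ 18 * D) :=
    a3.s1 (fun t h => ⟨h.1.s1, h.2⟩)
  have b1 := bad_g hT hD HD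
  have b2 : Cn (fun t => Good T t ∧ t.d ≠ 0 ∧ t.r ^ 2 = t.d * t.e) (10000 * T ^ 18 * D) :=
    b1.s2 (fun t h => ⟨h.1.s2, h.2.1, by simpa [s2] using h.2.2⟩)
  have b3 := bad_R hT hD HD
  have g := gen_count hT hD HD
  refine (a1.or (a2.or (a3.or (a4.or (b1.or (b2.or (b3.or g))))))).mono ?_ ?_
  · intro t h
    by_cases c1 : t.a = 0
    · exact Or.inl ⟨h, c1⟩
    by_cases c2 : t.c = 0
    · exact Or.inr (Or.inl ⟨h, c2⟩)
    by_cases c3 : t.d = 0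
    · exact Or.inr (Or.inr (Or.inl ⟨h, c3⟩))
    by_cases c4 : t.e = 0
    · exact Or.inr (Or.inr (Or.inr (Or.inl ⟨h, c4⟩)))
    by_cases c5 : t.p ^ 2 = t.a * t.c
    · exact Or.inr (Or.inr (Or.inr (Or.inr (Or.inl ⟨h, c1, c5⟩))))
    by_cases c6 : t.r ^ 2 = t.d * t.e
    · exact Or.inr (Or.inr (Or.inr (Or.inr (Or.inr (Or.inl ⟨h, c3, c6⟩)))))
    by_cases c7 : t.R = 0
    · exact Or.inr (Or.inr (Or.inr (Or.inr (Or.inr (Or.inr (Or.inl ⟨h, c1, c7⟩))))))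
    · exact Or.inr (Or.inr (Or.inr (Or.inr (Or.inr (Or.inr (Or.inr
        ⟨h, c1, c2, c3, c4, sub_ne_zero.2 c5, sub_ne_zero.2 c6, c7⟩))))))
  · have k1 : T ^ 18 * D ≤ T ^ 20 * D ^ 3 := by
      refine Nat.mul_le_mul (Nat.pow_le_pow_right hT (by norm_num)) ?_
      exact Nat.le_self_pow (by norm_num) D
    have k3 : 0 ≤ T ^ 20 * D ^ 3 := Nat.zero_le _
    linarith

open Tup

theorem pow_bound (K : ℕ) : ∃ c : ℕ, 1 ≤ c ∧ ∀ v : ℕ, (v + 1) ^ K ≤ c * 2 ^ v := by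
  have h := (tendsto_pow_const_div_const_pow_of_one_lt K (one_lt_two (α := ℝ))).bddAbove_range
  obtain ⟨B, hB⟩ := h
  have hB' : ∀ v : ℕ, ((v + 1 : ℕ) : ℝ) ^ K ≤ B * 2 ^ (v + 1) := by
    intro v
    have := hB ⟨v + 1, rfl⟩
    simp only at this
    rwa [div_le_iff₀ (by positivity)] at this
  refine ⟨2 * ⌈B⌉₊ + 1, by omega, fun v => ?_⟩
  have h1 := hB' v
  have h2 := Nat.le_ceil B
  have h3 : (0 : ℝ) < 2 ^ v := by positivity
  have : ((v + 1 : ℕ) : ℝ) ^ K ≤ (2 * ⌈B⌉₊ + 1) * 2 ^ v := by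
    rw [pow_succ] at h1
    nlinarith
  exact_mod_cast this

theorem card_divisors_pow_le (K : ℕ) : ∃ C : ℕ, 1 ≤ C ∧ ∀ n : ℕ, n ≠ 0 →
    n.divisors.card ^ K ≤ C * n := by
  obtain ⟨c, hc, h⟩ := pow_bound K
  refine ⟨c ^ (2 ^ K), Nat.one_le_pow _ _ hc, fun n hn => ?_⟩
  rw [Nat.card_divisors hn, ← Finset.prod_pow]
  have h1 : ∏ p ∈ n.primeFactors, (n.factorization p + 1) ^ K ≤
      ∏ p ∈ n.primeFactors, ((if p < 2 ^ K then c else 1) * p ^ n.factorization p) := by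
    refine Finset.prod_le_prod' fun p hp => ?_
    have hp2 : 2 ≤ p := (Nat.prime_of_mem_primeFactors hp).two_le
    split_ifs with hlt
    · exact (h _).trans (Nat.mul_le_mul_left _ (Nat.pow_le_pow_left hp2 _))
    · rw [one_mul]
      calc (n.factorization p + 1) ^ K ≤ (2 ^ n.factorization p) ^ K :=
            Nat.pow_le_pow_left (Nat.succ_le_of_lt Nat.lt_two_pow_self) _
        _ = (2 ^ K) ^ n.factorization p := by rw [← pow_mul, ← pow_mul, mul_comm]
        _ ≤ p ^ n.factorization p := Nat.pow_le_pow_left (not_lt.1 hlt) _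
  refine h1.trans ?_
  rw [Finset.prod_mul_distrib]
  have h2 : ∏ p ∈ n.primeFactors, p ^ n.factorization p = n := by
    exact Nat.prod_factorization_pow_eq_self hn
  rw [h2]
  refine Nat.mul_le_mul_right _ ?_
  rw [Finset.prod_ite, Finset.prod_const, Finset.prod_const_one, mul_one]
  refine Nat.pow_le_pow_right hc ?_
  calc _ ≤ (Finset.range (2 ^ K)).card := Finset.card_le_card (by
        intro p hp; simp only [Finset.mem_filter] at hp; exact Finset.mem_range.2 hp.2)
    _ = 2 ^ K := Finset.card_range _

theorem divB_exists : ∃ C : ℝ, 0 < C ∧ ∀ T : ℕ, 1 ≤ T → ∃ D : ℕ, 1 ≤ D ∧ DivB T D ∧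
    (D : ℝ) ≤ C * (T : ℝ) ^ (30 / 400 : ℝ) := by
  classical
  obtain ⟨C, hC, h⟩ := card_divisors_pow_le 400
  have hC' : (1 : ℝ) ≤ C := by exact_mod_cast hC
  refine ⟨2 * ((C : ℝ) * 256) ^ (1 / 400 : ℝ), by positivity, fun T hT => ?_⟩
  have hT' : (1 : ℝ) ≤ T := by exact_mod_cast hT
  have hbase : (1 : ℝ) ≤ (C : ℝ) * (256 * (T : ℝ) ^ 30) := by
    have : (1 : ℝ) ≤ (T : ℝ) ^ 30 := one_le_pow₀ hT'
    nlinarith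
  set E := ⌊((C : ℝ) * (256 * (T : ℝ) ^ 30)) ^ (1 / 400 : ℝ)⌋₊ with hE
  have hE1 : 1 ≤ E := by
    apply Nat.le_floor
    rw [Nat.cast_one]
    exact Real.one_le_rpow hbase (by norm_num)
  refine ⟨2 * E, by omega, ?_, ?_⟩
  · intro w hw hwb
    refine ⟨w.natAbs.divisors.image (fun k : ℕ => (k : ℤ)) ∪
      w.natAbs.divisors.image (fun k : ℕ => -(k : ℤ)), ?_, ?_⟩
    · have hd : w.natAbs.divisors.card ≤ E := by
        apply Nat.le_floor
        have h1 := h w.natAbs (Int.natAbs_ne_zero.2 hw)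
        have h2 : (w.natAbs : ℝ) ≤ 256 * (T : ℝ) ^ 30 := by
          have : ((w.natAbs : ℕ) : ℤ) ≤ 256 * (T : ℤ) ^ 30 := by
            rw [Int.natCast_natAbs]; exact hwb
          exact_mod_cast this
        have h3 : (w.natAbs.divisors.card : ℝ) ^ 400 ≤ (C : ℝ) * (256 * (T : ℝ) ^ 30) := by
          have : (w.natAbs.divisors.card : ℝ) ^ 400 ≤ (C : ℝ) * w.natAbs := by exact_mod_cast h1
          refine this.trans ?_
          gcongr
        calc (w.natAbs.divisors.card : ℝ)
            = ((w.natAbs.divisors.card : ℝ) ^ 400) ^ (1 / 400 : ℝ) := by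
              rw [← Real.rpow_natCast, ← Real.rpow_mul (by positivity)]; norm_num
          _ ≤ _ := Real.rpow_le_rpow (by positivity) h3 (by norm_num)
      refine (Finset.card_union_le _ _).trans ?_
      have i1 := Finset.card_image_le (s := w.natAbs.divisors) (f := fun k : ℕ => (k : ℤ))
      have i2 := Finset.card_image_le (s := w.natAbs.divisors) (f := fun k : ℕ => -(k : ℤ))
      omega
    · intro d hd
      have : d.natAbs ∈ w.natAbs.divisors :=
        Nat.mem_divisors.2 ⟨Int.natAbs_dvd_natAbs.2 hd, Int.natAbs_ne_zero.2 hw⟩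
      rcases Int.natAbs_eq d with e | e
      · exact Finset.mem_union_left _ (Finset.mem_image.2 ⟨_, this, e.symm⟩)
      · exact Finset.mem_union_right _ (Finset.mem_image.2 ⟨_, this, e.symm⟩)
  · push_cast
    have h1 : (E : ℝ) ≤ ((C : ℝ) * (256 * (T : ℝ) ^ 30)) ^ (1 / 400 : ℝ) :=
      Nat.floor_le (by positivity)
    have h2 : ((C : ℝ) * (256 * (T : ℝ) ^ 30)) ^ (1 / 400 : ℝ) =
        ((C : ℝ) * 256) ^ (1 / 400 : ℝ) * (T : ℝ) ^ (30 / 400 : ℝ) := by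
      rw [← mul_assoc, Real.mul_rpow (by positivity) (by positivity), ← Real.rpow_natCast,
        ← Real.rpow_mul (by positivity)]
      norm_num
    rw [h2] at h1
    linarith

open Tup

theorem dist_core {α β α' β' Q1 Q12 Q2 : ℚ} (hdet : α * β' - β * α' ≠ 0)
    (h1 : α ^ 2 * Q1 + 2 * α * β * Q12 + β ^ 2 * Q2 = 0)
    (h2 : α * α' * Q1 + (α * β' + β * α') * Q12 + β * β' * Q2 = 0) : Q12 ^ 2 = Q1 * Q2 := by
  have hA : α * Q1 + β * Q12 = 0 := by
    have : (α * β' - β * α') * (α * Q1 + β * Q12) = 0 := by linear_combination β' * h1 - β * h2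
    exact (mul_eq_zero.1 this).resolve_left hdet
  have hB : α * Q12 + β * Q2 = 0 := by
    have : (α * β' - β * α') * (α * Q12 + β * Q2) = 0 := by linear_combination α * h2 - α' * h1
    exact (mul_eq_zero.1 this).resolve_left hdet
  by_cases hα : α = 0
  · have hβ : β ≠ 0 := by
      rintro rfl
      apply hdet; rw [hα]; ring
    apply mul_left_cancel₀ hβ
    linear_combination Q12 * hA - Q1 * hB
  · apply mul_left_cancel₀ hα
    linear_combination Q12 * hB - Q2 * hA

theorem ruling {m n α β w1 w2 w3 w4 a x p z d r c y e : ℚ} (hmn : m ≠ 0 ∨ n ≠ 0)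
    (hP : m * w4 + n * w3 = 0) (hQ : n * w1 - m * w2 = 0)
    (hli : ∀ s t : ℚ, s * (m * α) + t * w1 = 0 → s * (n * α) + t * w2 = 0 →
      s * (m * β) + t * w3 = 0 → s * (-(n * β)) + t * w4 = 0 → s = 0 ∧ t = 0)
    (h1 : α ^ 2 * (m ^ 2 * a + 2 * m * n * x + n ^ 2 * d) +
      2 * α * β * (m ^ 2 * p - 2 * m * n * z - n ^ 2 * r) +
      β ^ 2 * (m ^ 2 * c - 2 * m * n * y + n ^ 2 * e) = 0)
    (h2 : m * α * (a * w1 + x * w2 + p * w3 + z * w4) + n * α * (x * w1 + d * w2 - z * w3 + r * w4) +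
      m * β * (p * w1 - z * w2 + c * w3 + y * w4) - n * β * (z * w1 + r * w2 + y * w3 + e * w4) = 0) :
    (m ^ 2 * p - 2 * m * n * z - n ^ 2 * r) ^ 2 =
      (m ^ 2 * a + 2 * m * n * x + n ^ 2 * d) * (m ^ 2 * c - 2 * m * n * y + n ^ 2 * e) := by
  have hs : m ^ 2 + n ^ 2 ≠ 0 := by
    rcases hmn with h | h
    · have := pow_pos (abs_pos.2 h) 2
      rw [sq_abs] at this
      nlinarith [sq_nonneg n]
    · have := pow_pos (abs_pos.2 h) 2
      rw [sq_abs] at this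
      nlinarith [sq_nonneg m]
  obtain ⟨α', hα'⟩ : ∃ α', α' = (m * w1 + n * w2) / (m ^ 2 + n ^ 2) := ⟨_, rfl⟩
  obtain ⟨β', hβ'⟩ : ∃ β', β' = (m * w3 - n * w4) / (m ^ 2 + n ^ 2) := ⟨_, rfl⟩
  rw [eq_div_iff hs] at hα' hβ'
  have e1 : w1 = m * α' := by
    apply mul_left_cancel₀ hs; linear_combination n * hQ - m * hα'
  have e2 : w2 = n * α' := by
    apply mul_left_cancel₀ hs; linear_combination -m * hQ - n * hα'
  have e3 : w3 = m * β' := by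
    apply mul_left_cancel₀ hs; linear_combination n * hP - m * hβ'
  have e4 : w4 = -(n * β') := by
    apply mul_left_cancel₀ hs; linear_combination m * hP + n * hβ'
  subst e1 e2 e3 e4
  refine dist_core (α := α) (β := β) (α' := α') (β' := β') ?_ h1 (by linear_combination h2)
  intro hdet
  have k1 := hli α' (-α) (by ring) (by ring) (by linear_combination -m * hdet)
    (by linear_combination n * hdet)
  have k2 := hli β' (-β) (by linear_combination m * hdet) (by linear_combination n * hdet) (by ring)
    (by ring)
  have a0 : α = 0 := by linarith [k1.2]
  have b0 : β = 0 := by linarith [k2.2]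
  have := hli 1 0 (by rw [a0]; ring) (by rw [a0]; ring) (by rw [b0]; ring) (by rw [b0]; ring)
  exact one_ne_zero this.1

theorem tensor {v1 v2 v3 v4 : ℚ} (h : v1 * v4 + v2 * v3 = 0) :
    ∃ m n α β : ℚ, v1 = m * α ∧ v2 = n * α ∧ v3 = m * β ∧ v4 = -(n * β) := by
  by_cases h1 : v1 = 0
  · by_cases h2 : v2 = 0
    · exact ⟨v3, -v4, 0, 1, by simp [h1], by simp [h2], by simp, by simp⟩
    · have h3 : v3 = 0 := by
        rw [h1, zero_mul, zero_add] at h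
        exact (mul_eq_zero.1 h).resolve_left h2
      exact ⟨0, v2, 1, -v4 / v2, by simp [h1], by simp, by simp [h3], by field_simp⟩
  · refine ⟨v1, v2, 1, v3 / v1, by simp, by simp, by field_simp, ?_⟩
    field_simp
    linear_combination h

theorem coprime_rep {m n : ℚ} (h : m ≠ 0 ∨ n ≠ 0) :
    ∃ (M N : ℤ) (l : ℚ), IsCoprime M N ∧ l ≠ 0 ∧ m = l * M ∧ n = l * N := by
  have hg : 0 < Int.gcd (m.num * n.den) (n.num * m.den) := by
    rw [Int.gcd_pos_iff]
    rcases h with h | h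
    · left; exact mul_ne_zero (Rat.num_ne_zero.2 h) (by exact_mod_cast n.den_ne_zero)
    · right; exact mul_ne_zero (Rat.num_ne_zero.2 h) (by exact_mod_cast m.den_ne_zero)
  obtain ⟨M, N, hc, hM, hN⟩ := Int.exists_gcd_one hg
  have dm : (m.den : ℚ) ≠ 0 := by exact_mod_cast m.den_ne_zero
  have dn : (n.den : ℚ) ≠ 0 := by exact_mod_cast n.den_ne_zero
  set g := Int.gcd (m.num * n.den) (n.num * m.den)
  have hg' : (g : ℚ) ≠ 0 := by exact_mod_cast hg.ne'
  have hM' : (m.num : ℚ) * n.den = M * g := by exact_mod_cast hM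
  have hN' : (n.num : ℚ) * m.den = N * g := by exact_mod_cast hN
  refine ⟨M, N, g / (m.den * n.den), Int.isCoprime_iff_gcd_eq_one.2 hc, by positivity, ?_, ?_⟩
  · have hm : m * m.den = m.num := Rat.mul_den_eq_num m
    rw [div_mul_eq_mul_div, eq_div_iff (mul_ne_zero dm dn)]
    linear_combination n.den * hm + hM'
  · have hn : n * n.den = n.num := Rat.mul_den_eq_num n
    rw [div_mul_eq_mul_div, eq_div_iff (mul_ne_zero dm dn)]
    linear_combination m.den * hn + hN'

/-- Quartic condition. -/
def QC (m n a x p z d r c y e : ℚ) : Prop :=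
  (m ^ 2 * p - 2 * m * n * z - n ^ 2 * r) ^ 2 =
      (m ^ 2 * a + 2 * m * n * x + n ^ 2 * d) * (m ^ 2 * c - 2 * m * n * y + n ^ 2 * e)

theorem dist_alg {v1 v2 v3 v4 w1 w2 w3 w4 a x p z d r c y e : ℚ}
    (hli : ∀ s t : ℚ, s * v1 + t * w1 = 0 → s * v2 + t * w2 = 0 →
      s * v3 + t * w3 = 0 → s * v4 + t * w4 = 0 → s = 0 ∧ t = 0)
    (hv : v1 * v4 + v2 * v3 = 0) (hw : w1 * w4 + w2 * w3 = 0)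
    (hvw : v1 * w4 + v2 * w3 + v3 * w2 + v4 * w1 = 0)
    (h1 : v1 * (a * v1 + x * v2 + p * v3 + z * v4) + v2 * (x * v1 + d * v2 - z * v3 + r * v4) +
      v3 * (p * v1 - z * v2 + c * v3 + y * v4) + v4 * (z * v1 + r * v2 + y * v3 + e * v4) = 0)
    (h2 : v1 * (a * w1 + x * w2 + p * w3 + z * w4) + v2 * (x * w1 + d * w2 - z * w3 + r * w4) +
      v3 * (p * w1 - z * w2 + c * w3 + y * w4) + v4 * (z * w1 + r * w2 + y * w3 + e * w4) = 0) :
    ∃ m n : ℚ, (m ≠ 0 ∨ n ≠ 0) ∧ (QC m n a x p z d r c y e ∨ QC m n a p x z c y d r e) := by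
  obtain ⟨m, n, α, β, rfl, rfl, rfl, rfl⟩ := tensor hv
  have hmn : m ≠ 0 ∨ n ≠ 0 := by
    by_contra hc
    push Not at hc
    have := hli 1 0 (by rw [hc.1]; ring) (by rw [hc.2]; ring) (by rw [hc.1]; ring)
      (by rw [hc.2]; ring)
    exact one_ne_zero this.1
  have hab : α ≠ 0 ∨ β ≠ 0 := by
    by_contra hc
    push Not at hc
    have := hli 1 0 (by rw [hc.1]; ring) (by rw [hc.1]; ring) (by rw [hc.2]; ring)
      (by rw [hc.2]; ring)
    exact one_ne_zero this.1
  have k : α * (m * w4 + n * w3) = β * (n * w1 - m * w2) := by linear_combination hvw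
  have k11 : (m * w4 + n * w3) * (β * w1 - α * w3) = 0 := by
    linear_combination m * β * hw - w3 * k
  have k12 : (m * w4 + n * w3) * (β * w2 + α * w4) = 0 := by
    linear_combination n * β * hw + w4 * k
  have k21 : (n * w1 - m * w2) * (β * w1 - α * w3) = 0 := by
    linear_combination m * α * hw - w1 * k
  have k22 : (n * w1 - m * w2) * (β * w2 + α * w4) = 0 := by
    linear_combination n * α * hw - w2 * k
  by_cases hr : m * w4 + n * w3 = 0 ∧ n * w1 - m * w2 = 0
  · refine ⟨m, n, hmn, Or.inl ?_⟩
    exact ruling hmn hr.1 hr.2 hli (by linear_combination h1) (by linear_combination h2)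
  · have hr' : β * w1 - α * w3 = 0 ∧ β * w2 + α * w4 = 0 := by
      by_cases hP : m * w4 + n * w3 = 0
      · have hQ : n * w1 - m * w2 ≠ 0 := fun h => hr ⟨hP, h⟩
        exact ⟨(mul_eq_zero.1 k21).resolve_left hQ, (mul_eq_zero.1 k22).resolve_left hQ⟩
      · exact ⟨(mul_eq_zero.1 k11).resolve_left hP, (mul_eq_zero.1 k12).resolve_left hP⟩
    refine ⟨α, β, hab, Or.inr ?_⟩
    refine ruling (α := m) (β := n) (w1 := w1) (w2 := w3) (w3 := w2) (w4 := w4) hab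
      (by linear_combination hr'.2) (by linear_combination hr'.1) ?_
      (by linear_combination h1) (by linear_combination h2)
    intro s t i1 i2 i3 i4
    exact hli s t (by linear_combination i1) (by linear_combination i3) (by linear_combination i2)
      (by linear_combination i4)

theorem dist_int {a x p z d r c y e : ℤ}
    (h : ∃ m n : ℚ, (m ≠ 0 ∨ n ≠ 0) ∧ (QC m n a x p z d r c y e ∨ QC m n a p x z c y d r e)) :
    ∃ M N : ℤ, IsCoprime M N ∧
      ((M ^ 2 * p - 2 * M * N * z - N ^ 2 * r) ^ 2 =
        (M ^ 2 * a + 2 * M * N * x + N ^ 2 * d) * (M ^ 2 * c - 2 * M * N * y + N ^ 2 * e) ∨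
      (M ^ 2 * x - 2 * M * N * z - N ^ 2 * y) ^ 2 =
        (M ^ 2 * a + 2 * M * N * p + N ^ 2 * c) * (M ^ 2 * d - 2 * M * N * r + N ^ 2 * e)) := by
  obtain ⟨m, n, hmn, h⟩ := h
  obtain ⟨M, N, l, hc, hl, rfl, rfl⟩ := coprime_rep hmn
  have hl4 : l ^ 4 ≠ 0 := pow_ne_zero _ hl
  refine ⟨M, N, hc, ?_⟩
  unfold QC at h
  rcases h with h | h
  · left
    have : ((M : ℚ) ^ 2 * p - 2 * M * N * z - N ^ 2 * r) ^ 2 =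
        (M ^ 2 * a + 2 * M * N * x + N ^ 2 * d) * (M ^ 2 * c - 2 * M * N * y + N ^ 2 * e) := by
      apply mul_left_cancel₀ hl4
      linear_combination h
    exact_mod_cast this
  · right
    have : ((M : ℚ) ^ 2 * x - 2 * M * N * z - N ^ 2 * y) ^ 2 =
        (M ^ 2 * a + 2 * M * N * p + N ^ 2 * c) * (M ^ 2 * d - 2 * M * N * r + N ^ 2 * e) := by
      apply mul_left_cancel₀ hl4
      linear_combination h
    exact_mod_cast this

open Tup

theorem qdist_int {b : Fin 9 → ℤ} (h : QDist b) :
    ∃ M N : ℤ, IsCoprime M N ∧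
      ((M ^ 2 * b 2 - 2 * M * N * b 3 - N ^ 2 * b 5) ^ 2 =
        (M ^ 2 * b 0 + 2 * M * N * b 1 + N ^ 2 * b 4) *
          (M ^ 2 * b 6 - 2 * M * N * b 7 + N ^ 2 * b 8) ∨
      (M ^ 2 * b 1 - 2 * M * N * b 3 - N ^ 2 * b 7) ^ 2 =
        (M ^ 2 * b 0 + 2 * M * N * b 2 + N ^ 2 * b 6) *
          (M ^ 2 * b 4 - 2 * M * N * b 5 + N ^ 2 * b 8)) := by
  obtain ⟨-, v, w, hli, h1, h2, h3, h4, h5⟩ := h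
  rw [LinearIndependent.pair_iff] at hli
  apply dist_int
  simp [Matrix.mulVec, dotProduct, Fin.sum_univ_four, A0] at h1 h3 h4
  simp [Matrix.mulVec, dotProduct, Fin.sum_univ_four, matOf] at h2 h5
  refine dist_alg (v1 := v 0) (v2 := v 1) (v3 := v 2) (v4 := v 3)
    (w1 := w 0) (w2 := w 1) (w3 := w 2) (w4 := w 3) ?_ ?_ ?_ ?_ ?_ ?_
  · intro s t e0 e1 e2 e3
    apply hli
    funext i
    fin_cases i <;> simp <;> assumption
  · linear_combination h1 / 2
  · linear_combination h3 / 2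
  · linear_combination h4
  · linear_combination h2
  · linear_combination h5

/-- Interchange of the second and third coordinates of the underlying space. -/
def swp (b : Fin 9 → ℤ) : Fin 9 → ℤ := ![b 0, b 2, b 1, b 3, b 6, b 7, b 4, b 5, b 8]

theorem dist_count {T D : ℕ} (hT : 1 ≤ T) (hD : 1 ≤ D) (HD : DivB T D) (S : Set (Fin 9 → ℤ))
    (hS : ∀ b ∈ S, (∀ i, |b i| ≤ (T : ℤ) ^ 3) ∧ qformZ b = 0 ∧ QDist b) :
    S.ncard ≤ 2 * (30000000 * T ^ 20 * D ^ 3) := by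
  obtain ⟨F, hF, hm⟩ := good_count hT hD HD
  have hsub : S ⊆ ((F ∪ F.image swp : Finset (Fin 9 → ℤ)) : Set (Fin 9 → ℤ)) := by
    intro b hb
    obtain ⟨hbox, hq, hd⟩ := hS b hb
    unfold qformZ at hq
    obtain ⟨M, N, hc, h | h⟩ := qdist_int hd
    · have := hm ⟨b 0, b 1, b 4, b 6, b 7, b 8, b 2, b 3, b 5, M, N⟩
        ⟨hbox _, hbox _, hbox _, hbox _, hbox _, hbox _, hbox _, hbox _, hbox _,
          by linear_combination -hq, h, hc⟩
      have e : (Tup.pr ⟨b 0, b 1, b 4, b 6, b 7, b 8, b 2, b 3, b 5, M, N⟩) = b := by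
        funext i
        fin_cases i <;> rfl
      rw [e] at this
      simp [this]
    · have := hm ⟨b 0, b 2, b 6, b 4, b 5, b 8, b 1, b 3, b 7, M, N⟩
        ⟨hbox _, hbox _, hbox _, hbox _, hbox _, hbox _, hbox _, hbox _, hbox _,
          by linear_combination -hq, h, hc⟩
      have e : swp (Tup.pr ⟨b 0, b 2, b 6, b 4, b 5, b 8, b 1, b 3, b 7, M, N⟩) = b := by
        funext i
        fin_cases i <;> rfl
      have h2 := Finset.mem_image_of_mem swp this
      rw [e] at h2
      rw [Finset.mem_coe, Finset.mem_union]
      exact Or.inr h2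
  calc S.ncard ≤ ((F ∪ F.image swp : Finset (Fin 9 → ℤ)) : Set (Fin 9 → ℤ)).ncard := Set.ncard_le_ncard hsub (Finset.finite_toSet (F ∪ F.image swp))
    _ = (F ∪ F.image swp).card := Set.ncard_coe_finset _
    _ ≤ F.card + (F.image swp).card := Finset.card_union_le _ _
    _ ≤ F.card + F.card := Nat.add_le_add_left Finset.card_image_le _
    _ ≤ _ := by omega

theorem real_est {T D : ℕ} {Cd Y : ℝ} (hT : 1 ≤ T) (hY : 1 ≤ Y)
    (hCd : 0 < Cd) (hD : (D : ℝ) ≤ Cd * (T : ℝ) ^ (30 / 400 : ℝ))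
    (hTY : (T : ℝ) ≤ 2 * Y ^ (1 / 3 : ℝ)) :
    (T : ℝ) ^ 20 * (D : ℝ) ^ 3 ≤ Cd ^ 3 * 2 ^ (809 / 40 : ℝ) * Y ^ (809 / 120 : ℝ) := by
  have hT0 : (0 : ℝ) < T := by exact_mod_cast hT
  have hY0 : (0 : ℝ) < Y := by linarith
  calc (T : ℝ) ^ 20 * (D : ℝ) ^ 3 ≤ (T : ℝ) ^ 20 * (Cd * (T : ℝ) ^ (30 / 400 : ℝ)) ^ 3 := by gcongr
    _ = Cd ^ 3 * (T : ℝ) ^ (809 / 40 : ℝ) := by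
      rw [mul_pow, ← Real.rpow_natCast ((T : ℝ) ^ (30 / 400 : ℝ)), ← Real.rpow_mul hT0.le,
        ← Real.rpow_natCast (T : ℝ) 20, mul_left_comm, ← Real.rpow_add hT0]
      norm_num
    _ ≤ Cd ^ 3 * (2 * Y ^ (1 / 3 : ℝ)) ^ (809 / 40 : ℝ) := by gcongr
    _ = _ := by
      rw [Real.mul_rpow (by norm_num) (by positivity), ← Real.rpow_mul hY0.le, mul_assoc]
      norm_num

/-- **Theorem 4.1**: the number of ℚ-distinguished integer points B in the box ℬ with
q(B) = 0 is O_ε(X^{209/30 + (137/45)δ + ε}). -/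
theorem stmt_10 (δ c₁ c₂ : ℝ) (hδ0 : 0 < δ) (hδ : δ < 0.01)
    (hc₁ : 0 < c₁) (hc₂ : 0 < c₂) :
    ∀ ε : ℝ, 0 < ε → ∃ C : ℝ, 0 < C ∧ ∀ x : ℝ, 1 ≤ x → ∀ Xb : Fin 9 → ℝ,
      (∀ i, c₁⁻¹ * x ^ (1 - 2 * δ) ≤ Xb i ∧ Xb i ≤ c₁ * x ^ (1 + 2 * δ)) →
      Xb 3 = c₂ * x →
      Xb 0 * Xb 8 = c₂ ^ 2 * x ^ 2 → Xb 4 * Xb 6 = c₂ ^ 2 * x ^ 2 →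
      Xb 1 * Xb 7 = c₂ ^ 2 * x ^ 2 → Xb 2 * Xb 5 = c₂ ^ 2 * x ^ 2 →
      ({b : Fin 9 → ℤ | (∀ i, (|b i| : ℝ) ≤ Xb i) ∧ qformZ b = 0 ∧ QDist b}.ncard : ℝ)
        ≤ C * x ^ ((209 / 30 : ℝ) + (137 / 45) * δ + ε) := by
  
  intro ε hε
  obtain ⟨Cd, hCd, hdiv⟩ := divB_exists
  set K : ℝ := max c₁ 1 with hK
  have hK1 : 1 ≤ K := le_max_right _ _
  have hK0 : 0 < K := by linarith
  refine ⟨60000000 * (Cd ^ 3 * 2 ^ (809 / 40 : ℝ) * K ^ (809 / 120 : ℝ)), by positivity, ?_⟩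
  intro x hx Xb hXb _ _ _ _ _
  have hx0 : 0 < x := by linarith
  obtain ⟨Y, hYdef⟩ : ∃ Y, Y = K * x ^ (1 + 2 * δ) := ⟨_, rfl⟩
  have hxp : 1 ≤ x ^ (1 + 2 * δ) := Real.one_le_rpow hx (by linarith)
  have hY1 : 1 ≤ Y := by rw [hYdef]; nlinarith
  have hY0 : 0 < Y := by linarith
  have hr1 : 1 ≤ Y ^ (1 / 3 : ℝ) := Real.one_le_rpow hY1 (by norm_num)
  obtain ⟨T, hTdef⟩ : ∃ T, T = ⌈Y ^ (1 / 3 : ℝ)⌉₊ := ⟨_, rfl⟩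
  have hTge : Y ^ (1 / 3 : ℝ) ≤ T := by rw [hTdef]; exact Nat.le_ceil _
  have hTle : (T : ℝ) ≤ 2 * Y ^ (1 / 3 : ℝ) := by
    have := Nat.ceil_lt_add_one (zero_le_one.trans hr1)
    rw [← hTdef] at this
    linarith
  have hT1 : 1 ≤ T := by
    have : (1 : ℝ) ≤ T := hr1.trans hTge
    exact_mod_cast this
  have hYT : Y ≤ (T : ℝ) ^ 3 := by
    calc Y = (Y ^ (1 / 3 : ℝ)) ^ 3 := by
          rw [← Real.rpow_natCast, ← Real.rpow_mul hY0.le]; norm_num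
      _ ≤ _ := by gcongr
  obtain ⟨D, hD1, HD, hDle⟩ := hdiv T hT1
  have hcount := dist_count hT1 hD1 HD
    {b : Fin 9 → ℤ | (∀ i, (|b i| : ℝ) ≤ Xb i) ∧ qformZ b = 0 ∧ QDist b} (by
      rintro b ⟨hb, hq, hd⟩
      refine ⟨fun i => ?_, hq, hd⟩
      have : (|b i| : ℝ) ≤ (T : ℝ) ^ 3 := by
        refine (hb i).trans ((hXb i).2.trans (le_trans ?_ hYT))
        rw [hYdef]
        gcongr
        exact le_max_left _ _
      exact_mod_cast this)
  have hest := real_est hT1 hY1 hCd hDle hTle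
  have hYx : Y ^ (809 / 120 : ℝ) ≤
      K ^ (809 / 120 : ℝ) * x ^ ((209 / 30 : ℝ) + (137 / 45) * δ + ε) := by
    rw [hYdef, Real.mul_rpow hK0.le (by positivity), ← Real.rpow_mul hx0.le]
    gcongr
    norm_num at hδ
    linarith
  have hc2 : ({b : Fin 9 → ℤ | (∀ i, (|b i| : ℝ) ≤ Xb i) ∧ qformZ b = 0 ∧ QDist b}.ncard : ℝ)
      ≤ 2 * (30000000 * (T : ℝ) ^ 20 * (D : ℝ) ^ 3) := by exact_mod_cast hcount
  calc _ ≤ _ := hc2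
    _ = 60000000 * ((T : ℝ) ^ 20 * (D : ℝ) ^ 3) := by ring
    _ ≤ 60000000 * (Cd ^ 3 * 2 ^ (809 / 40 : ℝ) * Y ^ (809 / 120 : ℝ)) := by gcongr
    _ ≤ 60000000 * (Cd ^ 3 * 2 ^ (809 / 40 : ℝ) *
        (K ^ (809 / 120 : ℝ) * x ^ ((209 / 30 : ℝ) + (137 / 45) * δ + ε))) := by gcongr
    _ = _ := by ring
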